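/- arXiv:2604.19006 — 3 statements merged into one kernel-verified Lean document; each statement's English description precedes it below -/
import Mathlib

section
/- Let f ∈ 𝒜, and suppose sup|D_xf|, sup|D_pf| and sup|D_{xp}f| are sufficiently small (below a positive threshold depending on the data). If (u₁,c₁) and (u₂,c₂) are two pairs, where each uⱼ ∈ C²(Ω̄) is uniformly convex, Duⱼ(Ω) = Ω̃, and Σ_{i=1}^n arctan(λᵢ(D²uⱼ(x))) = f(x, Duⱼ(x)) + cⱼ for all x ∈ Ω, then c₁ = c₂ and u₁ − u₂ is constant on Ω̄. -/
open Real Set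

noncomputable section

/-- `n`-dimensional Euclidean space. -/
abbrev Eucl (n : ℕ) : Type := EuclideanSpace ℝ (Fin n)

/-- The `i`-th partial derivative. -/
def pd {n : ℕ} (i : Fin n) (u : Eucl n → ℝ) (x : Eucl n) : ℝ :=
  fderiv ℝ u x (EuclideanSpace.single i 1)

/-- The gradient `Du`, as a point of Euclidean space. -/
def grad {n : ℕ} (u : Eucl n → ℝ) (x : Eucl n) : Eucl n :=
  (EuclideanSpace.equiv (Fin n) ℝ).symm fun i => pd i u x

/-- The Hessian matrix `D²u`. -/
def hess {n : ℕ} (u : Eucl n → ℝ) (x : Eucl n) : Matrix (Fin n) (Fin n) ℝ :=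
  Matrix.of fun i j => pd i (pd j u) x

/-- The eigenvalues of a matrix (with junk value `0` if it is not symmetric). -/
def eigs {n : ℕ} (A : Matrix (Fin n) (Fin n) ℝ) : Fin n → ℝ :=
  if hA : A.IsHermitian then hA.eigenvalues else 0

/-- `F[A] = ∑ᵢ arctan (λᵢ(A))`. -/
def Fop {n : ℕ} (A : Matrix (Fin n) (Fin n) ℝ) : ℝ :=
  ∑ i, Real.arctan (eigs A i)

/-- Operator norm of a matrix acting on Euclidean space. -/
def matNorm {n : ℕ} (A : Matrix (Fin n) (Fin n) ℝ) : ℝ :=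
  ‖Matrix.toEuclideanCLM (𝕜 := ℝ) A‖

/-- Loewner order `A ≤ B` on symmetric matrices: `B - A` is positive semidefinite. -/
def matLE {n : ℕ} (A B : Matrix (Fin n) (Fin n) ℝ) : Prop :=
  (B - A).PosSemidef

/-- The Euclidean dot product, written as a sum. -/
def ip {n : ℕ} (a b : Eucl n) : ℝ := ∑ i, a i * b i

/-- The quadratic form `∑ᵢⱼ aᵢ Mᵢⱼ bⱼ`. -/
def qf {n : ℕ} (M : Matrix (Fin n) (Fin n) ℝ) (a b : Eucl n) : ℝ :=
  ∑ i, ∑ j, a i * M i j * b j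

/-- A bounded, open, convex, nonempty domain. -/
structure NiceDomain {n : ℕ} (Ω : Set (Eucl n)) : Prop where
  isOpen : IsOpen Ω
  bounded : Bornology.IsBounded Ω
  convex : Convex ℝ Ω
  nonempty : Ω.Nonempty

/-- `h` is a defining function for the uniformly convex smooth domain `Ω`:
`Ω = {h > 0}`, `|Dh| = 1` on `∂Ω` and `-Θ·I ≤ D²h ≤ -θ·I` on `Ω`, `0 < θ < Θ`. -/
structure DefFn {n : ℕ} (Ω : Set (Eucl n)) (h : Eucl n → ℝ) (θ Θ : ℝ) : Prop where
  smooth : ContDiff ℝ (⊤ : ℕ∞) h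
  domain_eq : Ω = {p | 0 < h p}
  grad_unit : ∀ p ∈ frontier Ω, ‖grad h p‖ = 1
  theta_pos : 0 < θ
  theta_lt : θ < Θ
  hess_upper : ∀ p ∈ Ω, matLE (hess h p) (-(θ • (1 : Matrix (Fin n) (Fin n) ℝ)))
  hess_lower : ∀ p ∈ Ω, matLE (-(Θ • (1 : Matrix (Fin n) (Fin n) ℝ))) (hess h p)

/-- `f ∈ 𝒜`: `f` is `C²` on `cl Ω × cl Ω̃`, concave in `x` and convex in `p`. -/
structure MemA {n : ℕ} (Ω Ω' : Set (Eucl n)) (f : Eucl n → Eucl n → ℝ) : Prop where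
  reg : ContDiffOn ℝ 2 (fun q : Eucl n × Eucl n => f q.1 q.2) (closure Ω ×ˢ closure Ω')
  concave_x : ∀ p ∈ closure Ω', ConcaveOn ℝ (closure Ω) fun x => f x p
  convex_p : ∀ x ∈ closure Ω, ConvexOn ℝ (closure Ω') fun p => f x p

/-- The matrix of mixed second derivatives `(∂²f/∂xᵢ∂pⱼ)`. -/
def Dxp {n : ℕ} (f : Eucl n → Eucl n → ℝ) (x p : Eucl n) : Matrix (Fin n) (Fin n) ℝ :=
  Matrix.of fun i j => pd i (fun y => pd j (f y) p) x

/-- `sup |D_x f| ≤ (θΛ₁/2) · (1 / max_{cl Ω̃} |Dh|)`. -/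
def SmallDx {n : ℕ} (Ω Ω' : Set (Eucl n)) (h : Eucl n → ℝ) (θ Λ₁ : ℝ)
    (f : Eucl n → Eucl n → ℝ) : Prop :=
  ∀ x ∈ closure Ω, ∀ p ∈ closure Ω',
    ‖grad (fun y => f y p) x‖ ≤
      θ * Λ₁ / 2 * (1 / sSup ((fun q => ‖grad h q‖) '' closure Ω'))

/-- `sup |D_p f| ≤ (θ̃Λ₁/2) · (1 / max_{cl Ω} |Dh̃|)`. -/
def SmallDp {n : ℕ} (Ω Ω' : Set (Eucl n)) (ht : Eucl n → ℝ) (θt Λ₁ : ℝ)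
    (f : Eucl n → Eucl n → ℝ) : Prop :=
  ∀ x ∈ closure Ω, ∀ p ∈ closure Ω',
    ‖grad (f x) p‖ ≤ θt * Λ₁ / 2 * (1 / sSup ((fun q => ‖grad ht q‖) '' closure Ω))

/-- `sup |D_{xp} f| ≤ Λ₁θ̃ / (8 max_{cl Ω} |h̃|)`. -/
def SmallDxpTilde {n : ℕ} (Ω Ω' : Set (Eucl n)) (ht : Eucl n → ℝ) (θt Λ₁ : ℝ)
    (f : Eucl n → Eucl n → ℝ) : Prop :=
  ∀ x ∈ closure Ω, ∀ p ∈ closure Ω',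
    matNorm (Dxp f x p) ≤ Λ₁ * θt / (8 * sSup ((fun q => |ht q|) '' closure Ω))

/-- `sup |D_{xp} f| ≤ Λ₁θ / (8 max_{cl Ω̃} |h|)`. -/
def SmallDxpH {n : ℕ} (Ω Ω' : Set (Eucl n)) (h : Eucl n → ℝ) (θ Λ₁ : ℝ)
    (f : Eucl n → Eucl n → ℝ) : Prop :=
  ∀ x ∈ closure Ω, ∀ p ∈ closure Ω',
    matNorm (Dxp f x p) ≤ Λ₁ * θ / (8 * sSup ((fun q => |h q|) '' closure Ω'))

/-- A uniformly convex `C²(cl Ω)` solution of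
`∑ arctan λᵢ(D²u) = f(x,Du) + c` in `Ω`, `Du(Ω) = Ω̃`. -/
def IsSolGen {n : ℕ} (Ω Ω' : Set (Eucl n)) (f : Eucl n → Eucl n → ℝ)
    (u : Eucl n → ℝ) (c : ℝ) : Prop :=
  ContDiffOn ℝ 2 u (closure Ω) ∧
  (∃ a > (0 : ℝ), ∀ x ∈ closure Ω, matLE (a • (1 : Matrix (Fin n) (Fin n) ℝ)) (hess u x)) ∧
  (∀ x ∈ Ω, Fop (hess u x) = f x (grad u x) + c) ∧
  grad u '' Ω = Ω'

open Filter Topology Metric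

section MaximumPrinciple

variable {E : Type*} [NormedAddCommGroup E] [InnerProductSpace ℝ E]

lemma nonpos_of_isLocalMax_of_hasDerivAt {φ φ' : ℝ → ℝ} {c : ℝ} (hmax : IsLocalMax φ 0)
    (hφ : ∀ᶠ t in 𝓝 0, HasDerivAt φ (φ' t) t) (hφ' : HasDerivAt φ' c 0) : c ≤ 0 := by
  by_contra! hc
  have hev : deriv φ =ᶠ[𝓝 0] φ' := hφ.mono fun t ht => ht.deriv
  have hdd : deriv (deriv φ) 0 = c := by rw [hev.deriv_eq, hφ'.deriv]
  have hmin : IsLocalMin φ 0 :=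
    isLocalMin_of_deriv_deriv_pos (hdd ▸ hc) hmax.deriv_eq_zero hφ.self_of_nhds.continuousAt
  have hconst : φ =ᶠ[𝓝 0] fun _ => φ 0 := by
    filter_upwards [hmin, hmax] with t h1 h2 using le_antisymm h2 h1
  have hzero : deriv φ =ᶠ[𝓝 0] fun _ => 0 := by
    filter_upwards [hconst.eventuallyEq_nhds] with t ht
    rw [ht.deriv_eq, deriv_const]
  rw [hzero.deriv_eq, deriv_const] at hdd
  exact hc.ne hdd

lemma inner_hessian_nonpos_of_isLocalMax {w : E → ℝ} {g : E → E} {A : E →L[ℝ] E} {z : E}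
    (hmax : IsLocalMax w z) (hw : ∀ᶠ x in 𝓝 z, HasFDerivAt w (innerSL ℝ (g x)) x)
    (hg : HasFDerivAt g A z) (e : E) : inner ℝ (A e) e ≤ 0 := by
  have hline : ∀ t : ℝ, HasDerivAt (fun t : ℝ => z + t • e) e t := fun t => by
    simpa using ((hasDerivAt_id t).smul_const e).const_add z
  have hz : z + (0 : ℝ) • e = z := by simp
  have hcont : Tendsto (fun t : ℝ => z + t • e) (𝓝 0) (𝓝 z) := by
    simpa using (hline 0).continuousAt.tendsto
  refine nonpos_of_isLocalMax_of_hasDerivAt (φ := fun t => w (z + t • e))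
    (φ' := fun t => inner ℝ (g (z + t • e)) e) ?_ ?_ ?_
  · have : ∀ᶠ t in 𝓝 (0 : ℝ), w (z + t • e) ≤ w z := hcont.eventually hmax
    simpa [IsLocalMax, IsMaxFilter] using this
  · filter_upwards [hcont.eventually hw] with t ht
    simpa [Function.comp_def] using ht.comp_hasDerivAt t (hline t)
  · have h1 : HasDerivAt (fun t : ℝ => g (z + t • e)) (A e) 0 := by
      have : HasFDerivAt g A (z + (0 : ℝ) • e) := by rwa [hz]
      exact this.comp_hasDerivAt 0 (hline 0)
    simpa using h1.inner ℝ (hasDerivAt_const (0 : ℝ) e)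

/-- On `s`, the function `v` has gradient `g` and Hessian `A`, and satisfies
`tr (a A) + K |g| ≥ 0` for some symmetric `a = a(x)` with eigenvalues in `[lam, 1]`. -/
structure IsEllipticSubsolution (ι : Type*) [Fintype ι] (lam K : ℝ) (s : Set E)
    (v : E → ℝ) (g : E → E) (A : E → E →L[ℝ] E) : Prop where
  hasGrad : ∀ x ∈ s, HasFDerivAt v (innerSL ℝ (g x)) x
  hasHess : ∀ x ∈ s, HasFDerivAt g (A x) x
  ineq : ∀ x ∈ s, ∃ (b : OrthonormalBasis ι ℝ E) (w : ι → ℝ),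
    (∀ j, lam ≤ w j ∧ w j ≤ 1) ∧ 0 ≤ ∑ j, w j * inner ℝ (A x (b j)) (b j) + K * ‖g x‖

lemma IsEllipticSubsolution.mono {ι : Type*} [Fintype ι] {lam K : ℝ} {s t : Set E}
    {v : E → ℝ} {g : E → E} {A : E → E →L[ℝ] E} (h : IsEllipticSubsolution ι lam K s v g A)
    (hts : t ⊆ s) : IsEllipticSubsolution ι lam K t v g A :=
  ⟨fun x hx => h.hasGrad x (hts hx), fun x hx => h.hasHess x (hts hx),
    fun x hx => h.ineq x (hts hx)⟩

/-- Squared-radius defect `R² - |x - y|²`. -/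
def radialDefect (y : E) (R : ℝ) (x : E) : ℝ := R ^ 2 - ‖x - y‖ ^ 2

lemma hasFDerivAt_radialDefect (y : E) (R : ℝ) (x : E) :
    HasFDerivAt (radialDefect y R) (innerSL ℝ ((-2 : ℝ) • (x - y))) x := by
  have h := (((hasFDerivAt_id x).sub_const y).norm_sq).const_sub (R ^ 2)
  refine h.congr_fderiv ?_
  ext e
  simp

lemma continuous_radialDefect (y : E) (R : ℝ) : Continuous (radialDefect y R) :=
  continuous_iff_continuousAt.2 fun x => (hasFDerivAt_radialDefect y R x).continuousAt

/-- The barrier `s + C s²` with `s = R² - |x - y|²`. -/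
def hopfBarrier (y : E) (R C : ℝ) (x : E) : ℝ :=
  radialDefect y R x + C * radialDefect y R x ^ 2

/-- The gradient of the barrier. -/
def hopfBarrierGrad (y : E) (R C : ℝ) (x : E) : E :=
  (-2 * (1 + 2 * C * radialDefect y R x)) • (x - y)

lemma hasFDerivAt_hopfBarrier (y : E) (R C : ℝ) (x : E) :
    HasFDerivAt (hopfBarrier y R C) (innerSL ℝ (hopfBarrierGrad y R C x)) x := by
  have h := hasFDerivAt_radialDefect y R x
  refine (h.add ((h.pow 2).const_mul C)).congr_fderiv ?_
  ext e
  simp [hopfBarrierGrad]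
  ring

lemma continuous_hopfBarrier (y : E) (R C : ℝ) : Continuous (hopfBarrier y R C) :=
  continuous_iff_continuousAt.2 fun x => (hasFDerivAt_hopfBarrier y R C x).continuousAt

lemma exists_hasFDerivAt_hopfBarrierGrad (y : E) (R C : ℝ) (x : E) :
    ∃ A : E →L[ℝ] E, HasFDerivAt (hopfBarrierGrad y R C) A x ∧ ∀ e, inner ℝ (A e) e =
      8 * C * inner ℝ e (x - y) ^ 2 - 2 * (1 + 2 * C * radialDefect y R x) * ‖e‖ ^ 2 := by
  have h := hasFDerivAt_radialDefect y R x
  have h1 := (((h.const_mul (2 * C)).const_add 1).const_mul (-2)).smul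
    ((hasFDerivAt_id x).sub_const y)
  refine ⟨_, h1, fun e => ?_⟩
  have he : inner ℝ e (x - y) = inner ℝ x e - inner ℝ y e := by
    rw [real_inner_comm, inner_sub_left]
  simp [inner_smul_left, inner_add_left, real_inner_comm, he]
  ring

/-- The Hopf boundary point lemma on a ball. -/
theorem IsEllipticSubsolution.hopf [FiniteDimensional ℝ E] {ι : Type*} [Fintype ι]
    {lam K R M : ℝ} {v : E → ℝ} {g : E → E} {A : E → E →L[ℝ] E} {y x₀ p : E}
    (hv : IsEllipticSubsolution ι lam K (ball y R) v g A) (hlam : 0 < lam) (hK : 0 ≤ K)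
    (hR : 0 < R) (hcont : ContinuousOn v (closedBall y R)) (hlt : ∀ x ∈ ball y R, v x < M)
    (hle : ∀ x ∈ closedBall y R, v x ≤ M) (hx₀ : x₀ ∈ sphere y R) (hvx₀ : v x₀ = M)
    (hp : HasFDerivWithinAt v (innerSL ℝ p) (closedBall y R) x₀) :
    inner ℝ p (y - x₀) < 0 := by
  have hR2 : 0 < R ^ 2 := by positivity
  set N : ℝ := (Fintype.card ι : ℝ) with hN
  have hN0 : 0 ≤ N := by positivity
  obtain ⟨C, hC1, hC2⟩ : ∃ C : ℝ, 1 / R ^ 2 ≤ C ∧ (N + K * R) / (lam * R ^ 2) < C :=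
    ⟨max (1 / R ^ 2) ((N + K * R) / (lam * R ^ 2) + 1), le_max_left _ _,
      lt_of_lt_of_le (lt_add_one _) (le_max_right _ _)⟩
  have hC : 0 < C := lt_of_lt_of_le (by positivity) hC1
  rw [div_le_iff₀ hR2] at hC1
  rw [div_lt_iff₀ (by positivity)] at hC2
  set s₀ : ℝ := 1 / (2 * C) with hs₀
  have hs₀pos : 0 < s₀ := by positivity
  have hCs₀ : C * s₀ = 1 / 2 := by rw [hs₀]; field_simp
  have hs₀R : s₀ ≤ R ^ 2 / 2 := by nlinarith
  have hcd := continuous_radialDefect y R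
  have hdef0 : ∀ x ∈ closedBall y R, 0 ≤ radialDefect y R x := fun x hx => by
    rw [mem_closedBall, dist_eq_norm] at hx
    have := norm_nonneg (x - y)
    unfold radialDefect; nlinarith
  have hball : ∀ x, 0 < radialDefect y R x → x ∈ ball y R := fun x hx => by
    rw [mem_ball, dist_eq_norm]
    unfold radialDefect at hx
    nlinarith [norm_nonneg (x - y)]
  have hx₀d : radialDefect y R x₀ = 0 := by
    rw [mem_sphere, dist_eq_norm] at hx₀
    simp [radialDefect, hx₀]
  -- a gap on the inner part of the ball
  obtain ⟨η, hη, hgap⟩ : ∃ η > 0, ∀ x ∈ closedBall y R, s₀ ≤ radialDefect y R x → v x ≤ M - η := by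
    have hcpt : IsCompact (closedBall y R ∩ {x | s₀ ≤ radialDefect y R x}) :=
      (isCompact_closedBall y R).inter_right (isClosed_le continuous_const hcd)
    obtain ⟨z, hz, hzmax⟩ := hcpt.exists_isMaxOn
      ⟨y, mem_closedBall_self hR.le, by simp [radialDefect]; linarith⟩
      (hcont.mono inter_subset_left)
    refine ⟨M - v z, sub_pos.2 (hlt z (hball z (lt_of_lt_of_le hs₀pos hz.2))), fun x hx hxs => ?_⟩
    have : v x ≤ v z := hzmax ⟨hx, hxs⟩
    linarith
  set δ : ℝ := η / (2 * s₀) with hδ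
  have hδpos : 0 < δ := by positivity
  have hδs₀ : δ * s₀ = η / 2 := by rw [hδ]; field_simp
  set W : E → ℝ := fun x => v x + δ * hopfBarrier y R C x with hW
  have hWle : ∀ x ∈ closedBall y R, radialDefect y R x ≤ s₀ → W x ≤ M := by
    have hcpt : IsCompact (closedBall y R ∩ {x | radialDefect y R x ≤ s₀}) :=
      (isCompact_closedBall y R).inter_right (isClosed_le hcd continuous_const)
    have hWc : ContinuousOn W (closedBall y R) :=
      hcont.add ((continuous_hopfBarrier y R C).const_mul δ).continuousOn
    obtain ⟨z, ⟨hzb, hzs⟩, hzmax⟩ := hcpt.exists_isMaxOn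
      ⟨x₀, sphere_subset_closedBall hx₀, by simp [hx₀d, hs₀pos.le]⟩ (hWc.mono inter_subset_left)
    suffices hz : W z ≤ M from fun x hx hxs => le_trans (hzmax ⟨hx, hxs⟩) hz
    simp only [mem_ofPred_eq] at hzs
    rcases (hdef0 z hzb).eq_or_lt with h0 | h0
    · simpa [hW, hopfBarrier, ← h0] using hle z hzb
    rcases hzs.eq_or_lt with h1 | h1
    · have := hgap z hzb h1.ge
      simp only [hW, hopfBarrier, h1]
      nlinarith
    exfalso
    have hzball := hball z h0
    have hlocmax : IsLocalMax W z := by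
      have hopen : IsOpen {x | 0 < radialDefect y R x ∧ radialDefect y R x < s₀} :=
        (isOpen_lt continuous_const hcd).inter (isOpen_lt hcd continuous_const)
      filter_upwards [hopen.mem_nhds ⟨h0, h1⟩] with x hx
      exact hzmax ⟨ball_subset_closedBall (hball x hx.1), hx.2.le⟩
    have hWgrad : ∀ x ∈ ball y R,
        HasFDerivAt W (innerSL ℝ (g x + δ • hopfBarrierGrad y R C x)) x := fun x hx => by
      refine ((hv.hasGrad x hx).add ((hasFDerivAt_hopfBarrier y R C x).const_mul δ)).congr_fderiv ?_
      ext e; simp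
    obtain ⟨B, hB, hBe⟩ := exists_hasFDerivAt_hopfBarrierGrad y R C z
    have hgz : g z + δ • hopfBarrierGrad y R C z = 0 := by
      have := hlocmax.hasFDerivAt_eq_zero (hWgrad z hzball)
      have h2 := congrArg (fun L => L (g z + δ • hopfBarrierGrad y R C z)) this
      exact (inner_self_eq_zero (𝕜 := ℝ)).1 h2
    have hhess := fun e => inner_hessian_nonpos_of_isLocalMax hlocmax
      (by filter_upwards [isOpen_ball.mem_nhds hzball] with x hx using hWgrad x hx)
      ((hv.hasHess z hzball).add (hB.const_smul δ)) e
    set T : ℝ := 1 + 2 * C * radialDefect y R z with hT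
    have hT1 : 1 ≤ T := by rw [hT]; nlinarith [mul_pos hC h0]
    have hT2 : T ≤ 2 := by rw [hT]; nlinarith
    set r : ℝ := ‖z - y‖ with hr
    have hr0 : 0 ≤ r := norm_nonneg _
    have hrR : r ≤ R := by simpa [dist_eq_norm] using hzb
    have hr2 : R ^ 2 / 2 ≤ r ^ 2 := by
      have : radialDefect y R z = R ^ 2 - r ^ 2 := rfl
      linarith
    have hgn : ‖g z‖ = δ * (2 * T * r) := by
      rw [eq_neg_of_add_eq_zero_left hgz, norm_neg, norm_smul, hopfBarrierGrad, norm_smul,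
        Real.norm_eq_abs, Real.norm_eq_abs, abs_of_pos hδpos, ← hT, abs_of_neg (by linarith)]
      ring
    obtain ⟨b, w, hw, hsum⟩ := hv.ineq z hzball
    have hterm : ∀ j, w j * inner ℝ (A z (b j)) (b j) ≤
        -δ * (8 * C * lam * inner ℝ (b j) (z - y) ^ 2 - 4) := fun j => by
      have h1 := hhess (b j)
      simp only [add_apply, smul_apply, inner_add_left,
        inner_smul_left, hBe, OrthonormalBasis.norm_eq_one] at h1
      simp only [conj_trivial, one_pow, mul_one] at h1
      have hwj : 0 ≤ w j := hlam.le.trans (hw j).1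
      have h2 : w j * inner ℝ (A z (b j)) (b j) ≤
          w j * (-(δ * (8 * C * inner ℝ (b j) (z - y) ^ 2 - 2 * T))) :=
        mul_le_mul_of_nonneg_left (by linarith) hwj
      refine h2.trans ?_
      have h3 : lam * (8 * C * inner ℝ (b j) (z - y) ^ 2) ≤
          w j * (8 * C * inner ℝ (b j) (z - y) ^ 2) :=
        mul_le_mul_of_nonneg_right (hw j).1 (by positivity)
      have h4 : w j * (2 * T) ≤ 1 * 4 :=
        mul_le_mul (hw j).2 (by linarith) (by linarith) zero_le_one
      nlinarith
    have hs2 : ∑ j, w j * inner ℝ (A z (b j)) (b j) ≤ -δ * (8 * C * lam * r ^ 2 - 4 * N) := by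
      refine (Finset.sum_le_sum fun j _ => hterm j).trans_eq ?_
      rw [← Finset.mul_sum, Finset.sum_sub_distrib, ← Finset.mul_sum, b.sum_sq_inner_right]
      simp [hN, hr, mul_comm]
    rw [hgn] at hsum
    have h5 : K * (2 * T * r) ≤ K * (4 * R) :=
      mul_le_mul_of_nonneg_left (by nlinarith) hK
    have h6 : C * lam * (R ^ 2 / 2) ≤ C * lam * r ^ 2 :=
      mul_le_mul_of_nonneg_left hr2 (by positivity)
    have h7 : K * (2 * T * r) - (8 * C * lam * r ^ 2 - 4 * N) < 0 := by linarith
    have h8 := mul_neg_of_pos_of_neg hδpos h7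
    linarith
  have hWx₀ : W x₀ = M := by simp [hW, hopfBarrier, hx₀d, hvx₀]
  have hlocmax : IsLocalMaxOn W (closedBall y R) x₀ := by
    have hn : {x | radialDefect y R x < s₀} ∈ 𝓝 x₀ :=
      (isOpen_lt hcd continuous_const).mem_nhds (by simpa [hx₀d] using hs₀pos)
    filter_upwards [mem_nhdsWithin_of_mem_nhds hn, self_mem_nhdsWithin] with x hx hxb
    rw [hWx₀]
    exact hWle x hxb (le_of_lt hx)
  have hderiv := hp.add ((hasFDerivAt_hopfBarrier y R C x₀).const_mul δ).hasFDerivWithinAt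
  have hcone : y - x₀ ∈ posTangentConeAt (closedBall y R) x₀ :=
    sub_mem_posTangentConeAt_of_segment_subset
      ((convex_closedBall y R).segment_subset (sphere_subset_closedBall hx₀)
        (mem_closedBall_self hR.le))
  have hfin := hlocmax.hasFDerivWithinAt_nonpos hderiv hcone
  have hnorm : ‖x₀ - y‖ = R := by simpa [dist_eq_norm] using hx₀
  have hin : inner ℝ (x₀ - y) (y - x₀) = -R ^ 2 := by
    rw [← neg_sub x₀ y, inner_neg_right, real_inner_self_eq_norm_sq, hnorm]
  simp [hopfBarrierGrad, hx₀d, ← inner_sub_left, hin] at hfin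
  nlinarith [mul_pos hδpos hR2]

/-- The strong maximum principle. -/
theorem IsEllipticSubsolution.eq_or_lt [FiniteDimensional ℝ E] {ι : Type*} [Fintype ι]
    {lam K M : ℝ} {s : Set E} {v : E → ℝ} {g : E → E} {A : E → E →L[ℝ] E}
    (hv : IsEllipticSubsolution ι lam K s v g A) (hlam : 0 < lam) (hK : 0 ≤ K)
    (hs : IsOpen s) (hconn : IsPreconnected s) (hle : ∀ x ∈ s, v x ≤ M) :
    (∀ x ∈ s, v x = M) ∨ ∀ x ∈ s, v x < M := by
  by_cases hne : ∃ z ∈ s, v z = M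
  swap
  · push Not at hne
    exact Or.inr fun x hx => lt_of_le_of_ne (hle x hx) (hne x hx)
  left
  have hvc : ContinuousOn v s := fun x hx => (hv.hasGrad x hx).continuousAt.continuousWithinAt
  have hopen : IsOpen {x | x ∈ s ∧ v x = M} := by
    rw [Metric.isOpen_iff]
    rintro z ⟨hz, hvz⟩
    obtain ⟨ρ, hρ, hρs⟩ := Metric.isOpen_iff.1 hs z hz
    refine ⟨ρ / 2, by positivity, fun y hy => ?_⟩
    have hyz : dist y z < ρ / 2 := hy
    have hcb : closedBall y (dist z y) ⊆ s := fun x hx => hρs <| by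
      have hx' : dist x y ≤ dist z y := hx
      rw [mem_ball]
      rw [dist_comm z y] at hx'
      linarith [dist_triangle x y z]
    have hys : y ∈ s := hcb (mem_closedBall_self dist_nonneg)
    by_contra hcon
    have hvy : v y < M := lt_of_le_of_ne (hle y hys) fun h => hcon ⟨hys, h⟩
    have hcpt : IsCompact (closedBall y (dist z y) ∩ v ⁻¹' {M}) :=
      (isCompact_closedBall y _).of_isClosed_subset
        ((hvc.mono hcb).preimage_isClosed_of_isClosed isClosed_closedBall isClosed_singleton)
        inter_subset_left
    obtain ⟨x₀, ⟨hx₀b, hx₀v⟩, hx₀min⟩ := hcpt.exists_isMinOn (f := fun x => dist x y)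
      ⟨z, mem_closedBall.2 le_rfl, hvz⟩ (by fun_prop)
    have hx₀v : v x₀ = M := hx₀v
    have hR : 0 < dist x₀ y := dist_pos.2 fun h => by rw [← h, hx₀v] at hvy; exact lt_irrefl _ hvy
    have hsub : closedBall y (dist x₀ y) ⊆ s := (closedBall_subset_closedBall hx₀b).trans hcb
    have hx₀s : x₀ ∈ s := hcb hx₀b
    have hg : HasFDerivAt v (innerSL ℝ (g x₀)) x₀ := hv.hasGrad x₀ hx₀s
    have hlt : ∀ x ∈ ball y (dist x₀ y), v x < M := fun x hx => by
      have hxs := hsub (ball_subset_closedBall hx)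
      refine lt_of_le_of_ne (hle x hxs) fun h => ?_
      have h1 : dist x₀ y ≤ dist x y :=
        hx₀min ⟨closedBall_subset_closedBall hx₀b (ball_subset_closedBall hx), h⟩
      exact absurd (mem_ball.1 hx) (not_lt.2 h1)
    have hhopf := (hv.mono (ball_subset_closedBall.trans hsub)).hopf hlam hK hR (hvc.mono hsub) hlt
      (fun x hx => hle x (hsub hx)) (mem_sphere.2 rfl) hx₀v hg.hasFDerivWithinAt
    have hmax : IsLocalMax v x₀ := by
      filter_upwards [hs.mem_nhds hx₀s] with x hx
      rw [hx₀v]; exact hle x hx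
    have h0 := congrArg (fun L => L (y - x₀)) (hmax.hasFDerivAt_eq_zero hg)
    simp at h0
    exact hhopf.ne h0
  have hsub := hconn.subset_of_closure_inter_subset hopen
    (by obtain ⟨z, hz, hvz⟩ := hne; exact ⟨z, hz, hz, hvz⟩) (by
      rintro x ⟨hxc, hxs⟩
      refine ⟨hxs, ?_⟩
      have hcx := (hv.hasGrad x hxs).continuousAt
      have : v x ∈ closure ({M} : Set ℝ) :=
        hcx.continuousWithinAt.mem_closure hxc fun _ h => h.2
      simpa using this)
  exact fun x hx => (hsub hx).2

end MaximumPrinciple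

section ArctanOperator

lemma arctan_sub_arctan_le {a b : ℝ} (ha : 0 ≤ a) (hb : 0 ≤ b) :
    arctan a - arctan b ≤ (1 + b ^ 2)⁻¹ * (a - b) := by
  rcases le_total b a with h | h
  · refine (convex_Ici b).image_sub_le_mul_sub_of_deriv_le continuous_arctan.continuousOn
      differentiable_arctan.differentiableOn (fun t ht => ?_) b self_mem_Ici a h h
    rw [interior_Ici, mem_Ioi] at ht
    simp only [Real.deriv_arctan, one_div]
    gcongr
  · have := (convex_Icc 0 b).mul_sub_le_image_sub_of_le_deriv continuous_arctan.continuousOn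
      differentiable_arctan.differentiableOn (C := (1 + b ^ 2)⁻¹) (fun t ht => ?_)
      a ⟨ha, h⟩ b ⟨hb, le_rfl⟩ h
    · linarith
    · rw [interior_Icc] at ht
      simp only [Real.deriv_arctan, one_div]
      gcongr
      · exact ht.1.le
      · exact ht.2.le

variable {n : ℕ} {A B : Matrix (Fin n) (Fin n) ℝ}

lemma inner_toEuclideanCLM_left (hA : A.IsHermitian) (x y : Eucl n) :
    inner ℝ (Matrix.toEuclideanCLM (𝕜 := ℝ) A x) y =
      inner ℝ x (Matrix.toEuclideanCLM (𝕜 := ℝ) A y) :=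
  Matrix.isSymmetric_toEuclideanLin_iff.2 hA x y

lemma toEuclideanCLM_eigenvectorBasis (hA : A.IsHermitian) (i : Fin n) :
    Matrix.toEuclideanCLM (𝕜 := ℝ) A (hA.eigenvectorBasis i) =
      hA.eigenvalues i • hA.eigenvectorBasis i := by
  ext k
  simpa using congrFun (hA.mulVec_eigenvectorBasis i) k

/-- First-order concavity of `∑ arctan λᵢ` on positive semidefinite matrices. -/
lemma Fop_sub_le (hA : A.PosSemidef) (hB : B.PosSemidef) :
    Fop A - Fop B ≤ ∑ j, (1 + hB.1.eigenvalues j ^ 2)⁻¹ *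
      inner ℝ ((Matrix.toEuclideanCLM (𝕜 := ℝ) A - Matrix.toEuclideanCLM (𝕜 := ℝ) B)
        (hB.1.eigenvectorBasis j)) (hB.1.eigenvectorBasis j) := by
  set a := hA.1.eigenvectorBasis
  set b := hB.1.eigenvectorBasis
  set α := hA.1.eigenvalues
  set β := hB.1.eigenvalues
  have hrow : ∀ i, ∑ j, inner ℝ (a i) (b j) ^ 2 = 1 := fun i => by
    rw [b.sum_sq_inner_left, a.norm_eq_one, one_pow]
  have hcol : ∀ j, ∑ i, inner ℝ (a i) (b j) ^ 2 = 1 := fun j => by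
    rw [a.sum_sq_inner_right, b.norm_eq_one, one_pow]
  have hAb : ∀ j, inner ℝ (Matrix.toEuclideanCLM (𝕜 := ℝ) A (b j)) (b j) =
      ∑ i, inner ℝ (a i) (b j) ^ 2 * α i := fun j => by
    rw [← a.sum_inner_mul_inner]
    refine Finset.sum_congr rfl fun i _ => ?_
    rw [inner_toEuclideanCLM_left hA.1, toEuclideanCLM_eigenvectorBasis hA.1, inner_smul_right,
      real_inner_comm]
    ring
  have hBb : ∀ j, inner ℝ (Matrix.toEuclideanCLM (𝕜 := ℝ) B (b j)) (b j) =
      ∑ i, inner ℝ (a i) (b j) ^ 2 * β j := fun j => by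
    rw [← Finset.sum_mul, hcol, toEuclideanCLM_eigenvectorBasis hB.1, inner_smul_left,
      real_inner_self_eq_norm_sq, b.norm_eq_one]
    simp [β]
  have hFA : Fop A = ∑ j, ∑ i, inner ℝ (a i) (b j) ^ 2 * arctan (α i) := by
    rw [Finset.sum_comm]
    simp only [← Finset.sum_mul, hrow, one_mul]
    rw [Fop, eigs, dif_pos hA.1]
  have hFB : Fop B = ∑ j, ∑ i, inner ℝ (a i) (b j) ^ 2 * arctan (β j) := by
    simp only [← Finset.sum_mul, hcol, one_mul]
    rw [Fop, eigs, dif_pos hB.1]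
  rw [hFA, hFB, ← Finset.sum_sub_distrib]
  refine Finset.sum_le_sum fun j _ => ?_
  rw [sub_apply, inner_sub_left, hAb, hBb, ← Finset.sum_sub_distrib, ← Finset.sum_sub_distrib,
    Finset.mul_sum]
  refine Finset.sum_le_sum fun i _ => ?_
  have h := mul_le_mul_of_nonneg_left
    (arctan_sub_arctan_le (hA.eigenvalues_nonneg i) (hB.eigenvalues_nonneg j))
    (sq_nonneg (inner ℝ (a i) (b j)))
  linarith

lemma Matrix.PosSemidef.eigenvalues_le_trace (hA : A.PosSemidef) (i : Fin n) :
    hA.1.eigenvalues i ≤ A.trace := by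
  rw [hA.1.trace_eq_sum_eigenvalues]
  exact Finset.single_le_sum (f := hA.1.eigenvalues) (fun j _ => hA.eigenvalues_nonneg j)
    (Finset.mem_univ i)

lemma posSemidef_of_matLE {a : ℝ} (ha : 0 ≤ a)
    (h : matLE (a • (1 : Matrix (Fin n) (Fin n) ℝ)) A) : A.PosSemidef := by
  have h1 : (a • (1 : Matrix (Fin n) (Fin n) ℝ)).PosSemidef := Matrix.PosSemidef.one.smul ha
  simpa using Matrix.PosSemidef.add h h1

lemma le_inner_of_matLE {a : ℝ} (h : matLE (a • (1 : Matrix (Fin n) (Fin n) ℝ)) A) (e : Eucl n) :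
    a * ‖e‖ ^ 2 ≤ inner ℝ (Matrix.toEuclideanCLM (𝕜 := ℝ) A e) e := by
  have h1 := Matrix.PosSemidef.dotProduct_mulVec_nonneg h e.ofLp
  have h2 : ‖e‖ ^ 2 = e.ofLp ⬝ᵥ e.ofLp := by
    rw [← real_inner_self_eq_norm_sq, EuclideanSpace.inner_eq_star_dotProduct]; simp
  rw [EuclideanSpace.inner_eq_star_dotProduct, Matrix.ofLp_toEuclideanCLM, h2]
  simp [Matrix.sub_mulVec, Matrix.smul_mulVec, dotProduct_sub] at h1 ⊢
  linarith

lemma le_diag_of_matLE {a : ℝ} (h : matLE (a • (1 : Matrix (Fin n) (Fin n) ℝ)) A) (i : Fin n) :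
    a ≤ A i i := by
  have := Matrix.PosSemidef.diag_nonneg h (i := i)
  simpa using this

end ArctanOperator

section Gradient

variable {n : ℕ}

lemma inner_grad (u : Eucl n → ℝ) (x e : Eucl n) : inner ℝ (grad u x) e = fderiv ℝ u x e := by
  conv_rhs => rw [← (EuclideanSpace.basisFun (Fin n) ℝ).sum_repr e]
  simp [EuclideanSpace.inner_eq_star_dotProduct, dotProduct, grad, pd]

lemma innerSL_grad (u : Eucl n → ℝ) (x : Eucl n) : innerSL ℝ (grad u x) = fderiv ℝ u x := by
  ext1 e
  simp [inner_grad]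

lemma norm_grad (u : Eucl n → ℝ) (x : Eucl n) : ‖grad u x‖ = ‖fderiv ℝ u x‖ := by
  rw [← innerSL_grad, innerSL_apply_norm]

lemma DifferentiableAt.hasFDerivAt_innerSL_grad {u : Eucl n → ℝ} {x : Eucl n}
    (h : DifferentiableAt ℝ u x) : HasFDerivAt u (innerSL ℝ (grad u x)) x := by
  rw [innerSL_grad]; exact h.hasFDerivAt

lemma hasFDerivAt_grad {u : Eucl n → ℝ} {x : Eucl n} (hd : ∀ j, DifferentiableAt ℝ (pd j u) x)
    (hsym : (hess u x).IsHermitian) :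
    HasFDerivAt (grad u) (Matrix.toEuclideanCLM (𝕜 := ℝ) (hess u x)) x := by
  rw [← hasFDerivWithinAt_univ, hasFDerivWithinAt_euclidean]
  intro j
  rw [hasFDerivWithinAt_univ]
  refine ((hd j).hasFDerivAt : HasFDerivAt (pd j u) _ x).congr_fderiv ?_
  ext1 e
  have hs : ∀ i, hess u x j i = pd i (pd j u) x := fun i => by
    rw [← hsym.apply]; simp [hess]
  rw [← inner_grad]
  simp [EuclideanSpace.inner_eq_star_dotProduct, dotProduct, Matrix.mulVec, hs, grad, mul_comm]

lemma NiceDomain.uniqueDiffOn_closure {Ω : Set (Eucl n)} (hΩ : NiceDomain Ω) :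
    UniqueDiffOn ℝ (closure Ω) :=
  uniqueDiffOn_convex hΩ.convex.closure
    (hΩ.nonempty.mono (interior_maximal subset_closure hΩ.isOpen))

lemma NiceDomain.isCompact_closure {Ω : Set (Eucl n)} (hΩ : NiceDomain Ω) :
    IsCompact (closure Ω) := hΩ.bounded.isCompact_closure

lemma NiceDomain.closure_mem_nhds {Ω : Set (Eucl n)} (hΩ : NiceDomain Ω) {x : Eucl n}
    (hx : x ∈ Ω) : closure Ω ∈ 𝓝 x :=
  mem_of_superset (hΩ.isOpen.mem_nhds hx) subset_closure

/-- The Laplacian of a `C²(cl Ω)` function is bounded above on `Ω`. -/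
lemma NiceDomain.exists_trace_hess_le {Ω : Set (Eucl n)} (hΩ : NiceDomain Ω) {u : Eucl n → ℝ}
    (hu : ContDiffOn ℝ 2 u (closure Ω)) :
    ∃ C : ℝ, 0 ≤ C ∧ ∀ x ∈ Ω, (hess u x).trace ≤ C := by
  have hU := hΩ.uniqueDiffOn_closure
  set e : Fin n → Eucl n := fun i => EuclideanSpace.single i 1
  have h1 : ∀ i, ContDiffOn ℝ 1 (fun y => fderivWithin ℝ u (closure Ω) y (e i)) (closure Ω) :=
    fun i => (hu.fderivWithin hU (by norm_num)).clm_apply contDiffOn_const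
  have h2 : ∀ i, ContinuousOn (fun x => fderivWithin ℝ
      (fun y => fderivWithin ℝ u (closure Ω) y (e i)) (closure Ω) x (e i)) (closure Ω) :=
    fun i => ((h1 i).continuousOn_fderivWithin hU (by norm_num)).clm_apply continuousOn_const
  obtain ⟨C, hC⟩ := hΩ.isCompact_closure.exists_bound_of_continuousOn
    (continuousOn_finsetSum Finset.univ fun i _ => h2 i)
  refine ⟨|C|, abs_nonneg C, fun x hx => ?_⟩
  refine le_trans (le_of_eq ?_)
    ((le_abs_self _).trans ((hC x (subset_closure hx)).trans (le_abs_self C)))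
  refine Finset.sum_congr rfl fun i _ => ?_
  have hev : pd i u =ᶠ[𝓝 x] fun y => fderivWithin ℝ u (closure Ω) y (e i) := by
    filter_upwards [hΩ.isOpen.mem_nhds hx] with y hy
    rw [fderivWithin_of_mem_nhds (hΩ.closure_mem_nhds hy)]
    rfl
  rw [fderivWithin_of_mem_nhds (hΩ.closure_mem_nhds hx), ← hev.fderiv_eq]
  rfl

end Gradient

section Boundary

variable {n : ℕ}

lemma DefFn.frontier_eq_zero {Ω : Set (Eucl n)} {h : Eucl n → ℝ} {θ Θ : ℝ}
    (hh : DefFn Ω h θ Θ) {x : Eucl n} (hx : x ∈ frontier Ω) : h x = 0 := by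
  have hc : Continuous h := hh.smooth.continuous
  refine (frontier_lt_subset_eq continuous_const hc ?_ : (0 : ℝ) = h x).symm
  rwa [← hh.domain_eq]

lemma DefFn.nonneg_of_mem_closure {Ω : Set (Eucl n)} {h : Eucl n → ℝ} {θ Θ : ℝ}
    (hh : DefFn Ω h θ Θ) {x : Eucl n} (hx : x ∈ closure Ω) : 0 ≤ h x := by
  have hc : Continuous h := hh.smooth.continuous
  refine closure_lt_subset_le continuous_const hc ?_
  rwa [← hh.domain_eq]

/-- The interior ball condition. -/
lemma DefFn.exists_ball_subset {Ω : Set (Eucl n)} {h : Eucl n → ℝ} {θ Θ : ℝ}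
    (hh : DefFn Ω h θ Θ) {x₀ : Eucl n} (hx₀ : x₀ ∈ frontier Ω) :
    ∃ R > 0, ball (x₀ + R • grad h x₀) R ⊆ Ω := by
  have hsm : ContDiff ℝ 2 h := contDiff_infty.1 hh.smooth 2
  have hν := hh.grad_unit x₀ hx₀
  have h1 : ContDiff ℝ 1 (fderiv ℝ h) := hsm.fderiv_right (by norm_num)
  obtain ⟨K, t, ht, hL⟩ := h1.contDiffAt (x := x₀) |>.exists_lipschitzOnWith
  obtain ⟨ρ, hρ, hρt⟩ := Metric.mem_nhds_iff.1 ht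
  have hK : (0 : ℝ) ≤ K := K.2
  obtain ⟨R, hR, hRρ, hRK⟩ : ∃ R : ℝ, 0 < R ∧ 2 * R ≤ ρ ∧ 2 * R * K < 1 := by
    refine ⟨min (ρ / 2) (1 / (2 * (K + 1))), by positivity, ?_, ?_⟩
    · linarith [min_le_left (ρ / 2) (1 / (2 * ((K : ℝ) + 1)))]
    · have := min_le_right (ρ / 2) (1 / (2 * ((K : ℝ) + 1)))
      rw [le_div_iff₀ (by positivity)] at this
      have hpos : 0 < min (ρ / 2) (1 / (2 * ((K : ℝ) + 1))) := by positivity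
      nlinarith
  refine ⟨R, hR, fun x hx => ?_⟩
  set w := x - x₀ with hw
  have hxw : ‖w - R • grad h x₀‖ < R := by
    have : x - (x₀ + R • grad h x₀) = w - R • grad h x₀ := by rw [hw]; abel
    rwa [mem_ball, dist_eq_norm, this] at hx
  have hsq : ‖w‖ ^ 2 < 2 * R * inner ℝ w (grad h x₀) := by
    have h2 := norm_sub_sq_real w (R • grad h x₀)
    rw [inner_smul_right, norm_smul, hν, mul_one, Real.norm_eq_abs, sq_abs] at h2
    nlinarith [norm_nonneg (w - R • grad h x₀)]
  have hwlt : ‖w‖ < ρ := by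
    have h3 : ‖w‖ ≤ ‖w - R • grad h x₀‖ + ‖R • grad h x₀‖ := by
      simpa using norm_add_le (w - R • grad h x₀) (R • grad h x₀)
    rw [norm_smul, hν, mul_one, Real.norm_eq_abs, abs_of_pos hR] at h3
    linarith
  have hsub : closedBall x₀ ‖w‖ ⊆ t := (closedBall_subset_ball hwlt).trans hρt
  have htaylor := (convex_closedBall x₀ ‖w‖).norm_image_sub_le_of_norm_fderiv_le'
    (f := h) (C := K * ‖w‖) (φ := fderiv ℝ h x₀) (x := x₀) (y := x)
    (fun y _ => (hsm.differentiable (by norm_num)).differentiableAt)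
    (fun y hy => by
      have h4 := hL.norm_sub_le (hsub hy) (hsub (mem_closedBall_self (norm_nonneg _)))
      rw [mem_closedBall, dist_eq_norm] at hy
      exact h4.trans (mul_le_mul_of_nonneg_left hy hK))
    (mem_closedBall_self (norm_nonneg _)) (by simp [dist_eq_norm, hw])
  rw [hh.frontier_eq_zero hx₀, ← hw, ← inner_grad, Real.norm_eq_abs] at htaylor
  have h5 := (abs_le.1 htaylor).1
  rw [real_inner_comm] at h5
  have h6 : 0 < 2 * R * h x := by nlinarith [sq_nonneg ‖w‖]
  rw [hh.domain_eq]
  exact pos_of_mul_pos_right h6 (by positivity)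

/-- A covector nonnegative on a ball touching its zero set is a multiple of the inner normal. -/
lemma eq_norm_smul_of_inner_nonneg {E : Type*} [NormedAddCommGroup E] [InnerProductSpace ℝ E]
    {x₀ ν p : E} {R : ℝ} (hR : 0 < R) (hν : ‖ν‖ = 1)
    (h : ∀ z ∈ closedBall (x₀ + R • ν) R, 0 ≤ inner ℝ p (z - x₀)) : p = ‖p‖ • ν := by
  rcases eq_or_ne p 0 with rfl | hp
  · simp
  have hp0 : 0 < ‖p‖ := norm_pos_iff.2 hp
  have h1 := h (x₀ + R • ν - (R / ‖p‖) • p) (by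
    rw [mem_closedBall, dist_eq_norm]
    simp only [sub_sub_cancel_left, norm_neg, norm_smul, norm_div, Real.norm_eq_abs,
      abs_norm, abs_of_pos hR]
    rw [div_mul_cancel₀ _ hp0.ne'])
  have h2 : x₀ + R • ν - (R / ‖p‖) • p - x₀ = R • ν - (R / ‖p‖) • p := by abel
  rw [h2, inner_sub_right, inner_smul_right, inner_smul_right, real_inner_self_eq_norm_sq] at h1
  have h3 : R / ‖p‖ * ‖p‖ ^ 2 = R * ‖p‖ := by field_simp
  rw [h3, ← mul_sub] at h1
  have h4 : ‖p‖ ≤ inner ℝ p ν := by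
    have := nonneg_of_mul_nonneg_right h1 hR
    linarith
  have h5 : inner ℝ p ν ≤ ‖p‖ * ‖ν‖ := real_inner_le_norm p ν
  have h6 : inner ℝ p ν = ‖p‖ * ‖ν‖ := le_antisymm h5 (by rw [hν, mul_one]; exact h4)
  simpa [hν] using inner_eq_norm_mul_iff_real.1 h6

end Boundary

section Solutions

variable {n : ℕ} {Ω Ω' : Set (Eucl n)} {f : Eucl n → Eucl n → ℝ} {u : Eucl n → ℝ} {c : ℝ}

lemma IsSolGen.posSemidef_hess (hu : IsSolGen Ω Ω' f u c) {x : Eucl n} (hx : x ∈ closure Ω) :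
    (hess u x).PosSemidef := by
  obtain ⟨-, ⟨a, ha, hau⟩, -⟩ := hu
  exact posSemidef_of_matLE ha.le (hau x hx)

lemma IsSolGen.inner_hess_pos (hu : IsSolGen Ω Ω' f u c) {x : Eucl n} (hx : x ∈ closure Ω)
    {e : Eucl n} (he : e ≠ 0) :
    0 < inner ℝ (Matrix.toEuclideanCLM (𝕜 := ℝ) (hess u x) e) e := by
  obtain ⟨-, ⟨a, ha, hau⟩, -⟩ := hu
  have := norm_pos_iff.2 he
  exact lt_of_lt_of_le (by positivity) (le_inner_of_matLE (hau x hx) e)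

lemma IsSolGen.hasFDerivAt_grad (hu : IsSolGen Ω Ω' f u c) {x : Eucl n} (hx : x ∈ closure Ω) :
    HasFDerivAt (grad u) (Matrix.toEuclideanCLM (𝕜 := ℝ) (hess u x)) x := by
  refine _root_.hasFDerivAt_grad (fun j => ?_) (hu.posSemidef_hess hx).1
  obtain ⟨-, ⟨a, ha, hau⟩, -⟩ := hu
  by_contra hnd
  have h1 := le_diag_of_matLE (hau x hx) j
  have h2 : hess u x j j = 0 := by
    simp only [hess, Matrix.of_apply]
    rw [pd, fderiv_zero_of_not_differentiableAt hnd]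
    rfl
  linarith

lemma IsSolGen.hasFDerivAt (hΩ : NiceDomain Ω) (hu : IsSolGen Ω Ω' f u c) {x : Eucl n}
    (hx : x ∈ Ω) : HasFDerivAt u (innerSL ℝ (grad u x)) x :=
  ((hu.1.differentiableOn (by norm_num)).differentiableAt
    (hΩ.closure_mem_nhds hx)).hasFDerivAt_innerSL_grad

lemma IsSolGen.hasFDerivWithinAt (hΩ : NiceDomain Ω) (hu : IsSolGen Ω Ω' f u c) {x : Eucl n}
    (hx : x ∈ closure Ω) : HasFDerivWithinAt u (innerSL ℝ (grad u x)) (closure Ω) x := by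
  refine hasFDerivWithinAt_closure_of_tendsto_fderiv
    (fun y hy => (hu.hasFDerivAt hΩ hy).differentiableAt.differentiableWithinAt) hΩ.convex
    hΩ.isOpen (fun y hy => (hu.1.continuousOn y hy).mono subset_closure) ?_
  have hcont : ContinuousAt (fun y => fderiv ℝ u y) x := by
    simp only [← innerSL_grad]
    exact (innerSL ℝ).continuous.continuousAt.comp (hu.hasFDerivAt_grad hx).continuousAt
  rw [innerSL_grad]
  exact hcont.tendsto.mono_left nhdsWithin_le_nhds

lemma IsSolGen.grad_mem_closure (hu : IsSolGen Ω Ω' f u c) {x : Eucl n} (hx : x ∈ closure Ω) :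
    grad u x ∈ closure Ω' := by
  have := mem_closure_image (hu.hasFDerivAt_grad hx).continuousAt hx
  rwa [hu.2.2.2] at this

lemma IsSolGen.grad_mem (hu : IsSolGen Ω Ω' f u c) {x : Eucl n} (hx : x ∈ Ω) :
    grad u x ∈ Ω' := hu.2.2.2 ▸ mem_image_of_mem _ hx

lemma IsSolGen.injOn_grad (hΩ : NiceDomain Ω) (hu : IsSolGen Ω Ω' f u c) :
    InjOn (grad u) (closure Ω) := by
  intro x hx y hy hxy
  by_contra hne
  set e := y - x with he
  have he0 : e ≠ 0 := sub_ne_zero.2 (Ne.symm hne)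
  have hmem : ∀ t ∈ Icc (0 : ℝ) 1, x + t • e ∈ closure Ω := fun t ht =>
    hΩ.convex.closure.add_smul_sub_mem hx hy ht
  have hderiv : ∀ t ∈ Icc (0 : ℝ) 1, HasDerivAt (fun t : ℝ => inner ℝ (grad u (x + t • e)) e)
      (inner ℝ (Matrix.toEuclideanCLM (𝕜 := ℝ) (hess u (x + t • e)) e) e) t := fun t ht => by
    have hline : HasDerivAt (fun t : ℝ => x + t • e) e t := by
      simpa using ((hasDerivAt_id t).smul_const e).const_add x
    have h1 := (hu.hasFDerivAt_grad (hmem t ht)).comp_hasDerivAt t hline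
    simpa [Function.comp_def] using h1.inner ℝ (hasDerivAt_const t e)
  have hmono := strictMonoOn_of_deriv_pos (convex_Icc (0 : ℝ) 1)
    (fun t ht => (hderiv t ht).continuousAt.continuousWithinAt) (fun t ht => by
      have ht' := interior_subset ht
      rw [(hderiv t ht').deriv]
      exact hu.inner_hess_pos (hmem t ht') he0)
  have h2 := hmono (left_mem_Icc.2 zero_le_one) (right_mem_Icc.2 zero_le_one) zero_lt_one
  simp [he, hxy] at h2

lemma IsSolGen.grad_mem_frontier (hΩ : NiceDomain Ω) (hΩ' : NiceDomain Ω')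
    (hu : IsSolGen Ω Ω' f u c) {x : Eucl n} (hx : x ∈ frontier Ω) :
    grad u x ∈ frontier Ω' := by
  rw [hΩ'.isOpen.frontier_eq]
  rw [hΩ.isOpen.frontier_eq] at hx
  refine ⟨hu.grad_mem_closure hx.1, fun hmem => ?_⟩
  rw [← hu.2.2.2] at hmem
  obtain ⟨y, hy, hyx⟩ := hmem
  exact hx.2 (hu.injOn_grad hΩ (subset_closure hy) hx.1 hyx ▸ hy)

/-- Strict obliqueness of the boundary condition. -/
lemma IsSolGen.inner_grad_pos {h : Eucl n → ℝ} {θ Θ : ℝ} (hΩ : NiceDomain Ω)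
    (hΩ' : NiceDomain Ω') (hh : DefFn Ω' h θ Θ) (hu : IsSolGen Ω Ω' f u c) {x₀ ν : Eucl n} {R : ℝ}
    (hx₀ : x₀ ∈ frontier Ω) (hR : 0 < R) (hν : ‖ν‖ = 1)
    (hball : closedBall (x₀ + R • ν) R ⊆ closure Ω) :
    0 < inner ℝ ν (grad h (grad u x₀)) := by
  have hx₀c := frontier_subset_closure hx₀
  have hp := hu.grad_mem_frontier hΩ hΩ' hx₀
  set q := grad h (grad u x₀)
  set S := Matrix.toEuclideanCLM (𝕜 := ℝ) (hess u x₀)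
  have hq : ‖q‖ = 1 := hh.grad_unit _ hp
  have hq0 : q ≠ 0 := norm_ne_zero_iff.1 (by rw [hq]; exact one_ne_zero)
  have hH : HasFDerivAt (fun x => h (grad u x)) ((innerSL ℝ q).comp S) x₀ :=
    (hh.smooth.differentiable (by simp)).differentiableAt.hasFDerivAt_innerSL_grad.comp x₀
      (hu.hasFDerivAt_grad hx₀c)
  have hmin : IsMinOn (fun x => h (grad u x)) (closure Ω) x₀ := fun x hx => by
    have := hh.nonneg_of_mem_closure (hu.grad_mem_closure hx)
    simpa [hh.frontier_eq_zero hp] using this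
  have hSq : S q = ‖S q‖ • ν := by
    refine eq_norm_smul_of_inner_nonneg hR hν (x₀ := x₀) fun z hz => ?_
    have := hmin.localize.hasFDerivWithinAt_nonneg hH.hasFDerivWithinAt
      (sub_mem_posTangentConeAt_of_segment_subset
        (hΩ.convex.closure.segment_subset hx₀c (hball hz)))
    rw [inner_toEuclideanCLM_left (hu.posSemidef_hess hx₀c).1]
    simpa using this
  have hpos := hu.inner_hess_pos hx₀c hq0
  change 0 < inner ℝ (S q) q at hpos
  rw [hSq, inner_smul_left] at hpos
  exact pos_of_mul_pos_right hpos (by simp)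

lemma MemA.abs_sub_le (hf : MemA Ω Ω' f) (hΩ' : NiceDomain Ω') {ε : ℝ}
    (hfp : ∀ x ∈ closure Ω, ∀ p ∈ closure Ω', ‖grad (f x) p‖ ≤ ε) {x p q : Eucl n}
    (hx : x ∈ Ω) (hp : p ∈ Ω') (hq : q ∈ Ω') : |f x p - f x q| ≤ ε * ‖p - q‖ := by
  have hd : ∀ y ∈ Ω', DifferentiableAt ℝ (f x) y := fun y hy => by
    have hc : ContDiffOn ℝ 2 (f x) (closure Ω') :=
      hf.reg.comp (contDiff_const.prodMk contDiff_id).contDiffOn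
        fun z hz => ⟨subset_closure hx, hz⟩
    exact (hc.differentiableOn (by norm_num)).differentiableAt (hΩ'.closure_mem_nhds hy)
  exact hΩ'.convex.norm_image_sub_le_of_norm_fderiv_le hd
    (fun y hy => norm_grad (f x) y ▸ hfp x (subset_closure hx) y (subset_closure hy)) hq hp

/-- The difference of two solutions is a subsolution of a linear elliptic equation. -/
lemma IsSolGen.isEllipticSubsolution_sub {u₁ u₂ : Eucl n → ℝ} {c₁ c₂ : ℝ} (hΩ : NiceDomain Ω)
    (hΩ' : NiceDomain Ω') (hf : MemA Ω Ω' f) {ε : ℝ}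
    (hfp : ∀ x ∈ closure Ω, ∀ p ∈ closure Ω', ‖grad (f x) p‖ ≤ ε)
    (hu₁ : IsSolGen Ω Ω' f u₁ c₁) (hu₂ : IsSolGen Ω Ω' f u₂ c₂) (hc : c₂ ≤ c₁) :
    ∃ lam > 0, IsEllipticSubsolution (Fin n) lam ε Ω (fun x => u₁ x - u₂ x)
      (fun x => grad u₁ x - grad u₂ x) (fun x => Matrix.toEuclideanCLM (𝕜 := ℝ) (hess u₁ x) -
        Matrix.toEuclideanCLM (𝕜 := ℝ) (hess u₂ x)) := by
  obtain ⟨T, hT, hTu⟩ := hΩ.exists_trace_hess_le hu₂.1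
  refine ⟨(1 + T ^ 2)⁻¹, by positivity, fun x hx => ?_, fun x hx => ?_, fun x hx => ?_⟩
  · rw [map_sub]
    exact (hu₁.hasFDerivAt hΩ hx).sub (hu₂.hasFDerivAt hΩ hx)
  · exact (hu₁.hasFDerivAt_grad (subset_closure hx)).sub (hu₂.hasFDerivAt_grad (subset_closure hx))
  · have hA := hu₁.posSemidef_hess (subset_closure hx)
    have hB := hu₂.posSemidef_hess (subset_closure hx)
    refine ⟨hB.1.eigenvectorBasis, fun j => (1 + hB.1.eigenvalues j ^ 2)⁻¹, fun j => ⟨?_, ?_⟩, ?_⟩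
    · have h0 : 0 ≤ hB.1.eigenvalues j := hB.eigenvalues_nonneg j
      have h1 := (hB.eigenvalues_le_trace j).trans (hTu x hx)
      change (1 + T ^ 2)⁻¹ ≤ (1 + hB.1.eigenvalues j ^ 2)⁻¹
      gcongr
    · exact inv_le_one_of_one_le₀ (by nlinarith [sq_nonneg (hB.1.eigenvalues j)])
    · have h1 := Fop_sub_le hA hB
      rw [hu₁.2.2.1 x hx, hu₂.2.2.1 x hx] at h1
      have h2 := (abs_le.1 (hf.abs_sub_le hΩ' hfp hx (hu₁.grad_mem hx) (hu₂.grad_mem hx))).1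
      linarith

theorem IsSolGen.exists_sub_eq_of_le {h ht u₁ u₂ : Eucl n → ℝ} {θ Θ θt Θt c₁ c₂ : ℝ}
    (hΩ : NiceDomain Ω) (hΩ' : NiceDomain Ω') (hh : DefFn Ω' h θ Θ) (hht : DefFn Ω ht θt Θt)
    (hf : MemA Ω Ω' f) {ε : ℝ} (hε : 0 ≤ ε)
    (hfp : ∀ x ∈ closure Ω, ∀ p ∈ closure Ω', ‖grad (f x) p‖ ≤ ε)
    (hu₁ : IsSolGen Ω Ω' f u₁ c₁) (hu₂ : IsSolGen Ω Ω' f u₂ c₂) (hc : c₂ ≤ c₁) :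
    ∃ b : ℝ, ∀ x ∈ closure Ω, u₁ x - u₂ x = b := by
  obtain ⟨lam, hlam, hsub⟩ := hu₁.isEllipticSubsolution_sub hΩ hΩ' hf hfp hu₂ hc
  have hcont : ContinuousOn (fun x => u₁ x - u₂ x) (closure Ω) :=
    hu₁.1.continuousOn.sub hu₂.1.continuousOn
  obtain ⟨x₀, hx₀, hmax⟩ := hΩ.isCompact_closure.exists_isMaxOn hΩ.nonempty.closure hcont
  have hle : ∀ x ∈ closure Ω, u₁ x - u₂ x ≤ u₁ x₀ - u₂ x₀ := fun x hx => hmax hx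
  refine ⟨u₁ x₀ - u₂ x₀, ?_⟩
  rcases hsub.eq_or_lt hlam hε hΩ.isOpen hΩ.convex.isPreconnected
    (fun x hx => hle x (subset_closure hx)) with heq | hlt
  · intro x hx
    have := (hcont x hx).mono subset_closure |>.mem_closure hx
      (t := {u₁ x₀ - u₂ x₀}) fun y hy => heq y hy
    simpa using this
  exfalso
  have hfr : x₀ ∈ frontier Ω := by
    rw [hΩ.isOpen.frontier_eq]
    exact ⟨hx₀, fun hmem => lt_irrefl _ (hlt x₀ hmem)⟩
  obtain ⟨R, hR, hball⟩ := hht.exists_ball_subset hfr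
  set ν := grad ht x₀
  have hν : ‖ν‖ = 1 := hht.grad_unit x₀ hfr
  have hcb : closedBall (x₀ + R • ν) R ⊆ closure Ω := by
    rw [← closure_ball _ hR.ne']
    exact closure_mono hball
  set p₁ := grad u₁ x₀
  set p₂ := grad u₂ x₀
  have hp₁ : p₁ ∈ frontier Ω' := hu₁.grad_mem_frontier hΩ hΩ' hfr
  have hp₂ : p₂ ∈ frontier Ω' := hu₂.grad_mem_frontier hΩ hΩ' hfr
  have hderiv : HasFDerivWithinAt (fun x => u₁ x - u₂ x) (innerSL ℝ (p₁ - p₂)) (closure Ω) x₀ := by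
    rw [map_sub]
    exact (hu₁.hasFDerivWithinAt hΩ hx₀).sub (hu₂.hasFDerivWithinAt hΩ hx₀)
  have hnormal : p₂ - p₁ = ‖p₂ - p₁‖ • ν := by
    refine eq_norm_smul_of_inner_nonneg hR hν (x₀ := x₀) fun z hz => ?_
    have := hmax.localize.hasFDerivWithinAt_nonpos hderiv
      (sub_mem_posTangentConeAt_of_segment_subset
        (hΩ.convex.closure.segment_subset hx₀ (hcb hz)))
    rw [innerSL_apply_apply] at this
    rw [← neg_sub p₁ p₂, inner_neg_left]
    linarith
  have hhopf := (hsub.mono hball).hopf hlam hε hR (hcont.mono hcb) (fun x hx => hlt x (hball hx))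
    (fun x hx => hle x (hcb hx)) (by simp [norm_smul, hν, abs_of_pos hR]) rfl
    (hderiv.mono hcb)
  have hne : 0 < ‖p₂ - p₁‖ := by
    rw [norm_pos_iff, sub_ne_zero]
    intro heq
    simp [heq] at hhopf
  have hobl := hu₂.inner_grad_pos hΩ hΩ' hh hfr hR hν hcb
  have hmin : IsMinOn h (closure Ω') p₂ := fun p hp => by
    have := hh.nonneg_of_mem_closure hp
    simpa [hh.frontier_eq_zero hp₂] using this
  have hge := hmin.localize.hasFDerivWithinAt_nonneg
    ((hh.smooth.differentiable (by simp)).differentiableAt.hasFDerivAt_innerSL_grad).hasFDerivWithinAt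
    (sub_mem_posTangentConeAt_of_segment_subset (hΩ'.convex.closure.segment_subset
      (frontier_subset_closure hp₂) (frontier_subset_closure hp₁)))
  rw [innerSL_apply_apply, ← neg_sub p₂ p₁, hnormal, inner_neg_right, inner_smul_right,
    real_inner_comm] at hge
  linarith [mul_pos hne hobl]

lemma IsSolGen.constants_eq {u₁ u₂ : Eucl n → ℝ} {c₁ c₂ b : ℝ} (hΩ : NiceDomain Ω)
    (hu₁ : IsSolGen Ω Ω' f u₁ c₁) (hu₂ : IsSolGen Ω Ω' f u₂ c₂)
    (hb : ∀ x ∈ closure Ω, u₁ x - u₂ x = b) : c₁ = c₂ := by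
  obtain ⟨x, hx⟩ := hΩ.nonempty
  have hfd : ∀ y ∈ Ω, fderiv ℝ u₁ y = fderiv ℝ u₂ y := fun y hy => by
    have hev : u₁ =ᶠ[𝓝 y] fun z => u₂ z + b := by
      filter_upwards [hΩ.closure_mem_nhds hy] with z hz
      linarith [hb z hz]
    rw [hev.fderiv_eq, fderiv_add_const]
  have hpd : ∀ i, ∀ y ∈ Ω, pd i u₁ y = pd i u₂ y := fun i y hy => by
    simp only [pd, hfd y hy]
  have hgrad : grad u₁ x = grad u₂ x := by simp only [grad, hpd _ x hx]
  have hhess : hess u₁ x = hess u₂ x := by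
    ext i j
    have hev : pd j u₁ =ᶠ[𝓝 x] pd j u₂ := by
      filter_upwards [hΩ.isOpen.mem_nhds hx] with y hy using hpd j y hy
    simp only [hess, Matrix.of_apply]
    rw [pd, hev.fderiv_eq]
    rfl
  have h1 := hu₁.2.2.1 x hx
  have h2 := hu₂.2.2.1 x hx
  rw [hhess, hgrad] at h1
  linarith

end Solutions

theorem stmt_1 {n : ℕ} (hn : 2 ≤ n) {Ω Ω' : Set (Eucl n)} {h ht : Eucl n → ℝ}
    {θ Θ θt Θt : ℝ}
    (hΩ : NiceDomain Ω) (hΩ' : NiceDomain Ω')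
    (hdefh : DefFn Ω' h θ Θ) (hdefht : DefFn Ω ht θt Θt) :
    ∃ ε > (0 : ℝ), ∀ f : Eucl n → Eucl n → ℝ, MemA Ω Ω' f →
      (∀ x ∈ closure Ω, ∀ p ∈ closure Ω', ‖grad (fun y => f y p) x‖ ≤ ε) →
      (∀ x ∈ closure Ω, ∀ p ∈ closure Ω', ‖grad (f x) p‖ ≤ ε) →
      (∀ x ∈ closure Ω, ∀ p ∈ closure Ω', matNorm (Dxp f x p) ≤ ε) →
      ∀ u₁ c₁ u₂ c₂, IsSolGen Ω Ω' f u₁ c₁ → IsSolGen Ω Ω' f u₂ c₂ →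
        c₁ = c₂ ∧ ∃ b : ℝ, ∀ x ∈ closure Ω, u₁ x - u₂ x = b := by
  refine ⟨1, one_pos, fun f hf _ hfp _ u₁ c₁ u₂ c₂ hu₁ hu₂ => ?_⟩
  have hb : ∃ b : ℝ, ∀ x ∈ closure Ω, u₁ x - u₂ x = b := by
    rcases le_total c₂ c₁ with hc | hc
    · exact hu₁.exists_sub_eq_of_le hΩ hΩ' hdefh hdefht hf zero_le_one hfp hu₂ hc
    · obtain ⟨b, hb⟩ := hu₂.exists_sub_eq_of_le hΩ hΩ' hdefh hdefht hf zero_le_one hfp hu₁ hc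
      exact ⟨-b, fun x hx => by linarith [hb x hx]⟩
  obtain ⟨b, hb⟩ := hb
  exact ⟨hu₁.constants_eq hΩ hu₂ hb, b, hb⟩
end
end

section
/- Let f ∈ 𝒜 and let u be a strictly convex solution of the flow on Ω̄ × [0,T]. Then for all (x,t) ∈ Ω̄ × [0,T], min_{Ω̄} F[D²u₀] − max_{x∈Ω̄} f(x, Du₀(x)) ≤ ∂u/∂t(x,t) ≤ max_{Ω̄} F[D²u₀] − min_{x∈Ω̄} f(x, Du₀(x)). -/
open Real Set

noncomputable section

/-- The initial datum `u₀`: uniformly convex on `cl Ω`, of class `C^{2+α}`,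
with `Du₀(Ω) = Ω̃`. -/
structure InitData {n : ℕ} (Ω Ω' : Set (Eucl n)) (α : NNReal) (u₀ : Eucl n → ℝ) : Prop where
  alpha_pos : 0 < α
  alpha_lt_one : α < 1
  reg : ContDiffOn ℝ 2 u₀ (closure Ω)
  holder : ∃ C : NNReal, ∀ i j, HolderOnWith C α (fun x => hess u₀ x i j) (closure Ω)
  uconv : ∃ c > (0 : ℝ), ∀ x ∈ closure Ω,
    matLE (c • (1 : Matrix (Fin n) (Fin n) ℝ)) (hess u₀ x)
  grad_onto : grad u₀ '' Ω = Ω'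

/-- `max_{cl Ω} F[D²u₀]`. -/
def maxF {n : ℕ} (Ω : Set (Eucl n)) (u₀ : Eucl n → ℝ) : ℝ :=
  sSup ((fun x => Fop (hess u₀ x)) '' closure Ω)

/-- `min_{cl Ω} F[D²u₀]`. -/
def minF {n : ℕ} (Ω : Set (Eucl n)) (u₀ : Eucl n → ℝ) : ℝ :=
  sInf ((fun x => Fop (hess u₀ x)) '' closure Ω)

/-- A strictly convex solution of the flow
`∂u/∂t = F[D²u] - f(x,Du)` in `Ω × (0,T]`, `h(Du) = 0` on `∂Ω × (0,T]`, `u(·,0) = u₀`,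
on `cl Ω × [0,T]`: continuous together with its spatial derivatives up to order two
and its time derivative on `cl Ω × [0,T]`, `C⁴` in `x` and `C²` in `t` in `Ω × (0,T]`,
and strictly convex in `x`. -/
structure FlowSol {n : ℕ} (Ω : Set (Eucl n)) (h : Eucl n → ℝ) (f : Eucl n → Eucl n → ℝ)
    (u₀ : Eucl n → ℝ) (T : ℝ) (u : Eucl n → ℝ → ℝ) : Prop where
  cont : ContinuousOn (fun q : Eucl n × ℝ => u q.1 q.2) (closure Ω ×ˢ Icc 0 T)
  cont_pd : ∀ i, ContinuousOn (fun q : Eucl n × ℝ => pd i (fun y => u y q.2) q.1)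
    (closure Ω ×ˢ Icc 0 T)
  cont_hess : ∀ i j, ContinuousOn (fun q : Eucl n × ℝ => hess (fun y => u y q.2) q.1 i j)
    (closure Ω ×ˢ Icc 0 T)
  cont_time : ContinuousOn (fun q : Eucl n × ℝ => deriv (u q.1) q.2) (closure Ω ×ˢ Icc 0 T)
  regx : ∀ t ∈ Ioc (0 : ℝ) T, ContDiffOn ℝ 4 (fun y => u y t) Ω
  regt : ∀ x ∈ Ω, ContDiffOn ℝ 2 (u x) (Ioc (0 : ℝ) T)
  sconv : ∀ t ∈ Ioc (0 : ℝ) T, ∀ x ∈ Ω, (hess (fun y => u y t) x).PosDef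
  eqn : ∀ t ∈ Ioc (0 : ℝ) T, ∀ x ∈ Ω,
    deriv (u x) t = Fop (hess (fun y => u y t) x) - f x (grad (fun y => u y t) x)
  bdry : ∀ t ∈ Ioc (0 : ℝ) T, ∀ x ∈ frontier Ω, h (grad (fun y => u y t) x) = 0
  init : ∀ x ∈ closure Ω, u x 0 = u₀ x

open Filter Topology

/-! ### Eigenvalue monotonicity -/

lemma qf_eq_inner {n : ℕ} (A : Matrix (Fin n) (Fin n) ℝ) (x y : Eucl n) :
    qf A x y = inner ℝ x (Matrix.toEuclideanLin A y) := by
  simp only [qf, PiLp.inner_apply, Matrix.toLpLin_apply, Matrix.mulVec, dotProduct]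
  refine Finset.sum_congr rfl fun i _ => ?_
  simp only [RCLike.inner_apply, conj_trivial, Finset.sum_mul]
  exact Finset.sum_congr rfl fun j _ => by ring

lemma qf_eq_dotProduct {n : ℕ} (A : Matrix (Fin n) (Fin n) ℝ) (x y : Eucl n) :
    qf A x y = dotProduct (x : Fin n → ℝ) (A.mulVec y) := by
  simp only [qf, Matrix.mulVec, dotProduct, Finset.mul_sum, mul_assoc]

lemma qf_eq_sum_eigenvalues {n : ℕ} {A : Matrix (Fin n) (Fin n) ℝ} (hA : A.IsHermitian)
    (x : Eucl n) :
    qf A x x = ∑ j, hA.eigenvalues j * (inner ℝ (hA.eigenvectorBasis j) x) ^ 2 := by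
  rw [qf_eq_inner, ← hA.eigenvectorBasis.sum_inner_mul_inner]
  refine Finset.sum_congr rfl fun j _ => ?_
  have hsymm := Matrix.isSymmetric_toEuclideanLin_iff.mpr hA
  have hev : Matrix.toEuclideanLin A (hA.eigenvectorBasis j)
      = hA.eigenvalues j • hA.eigenvectorBasis j := by
    ext k
    have := congrFun (hA.mulVec_eigenvectorBasis j) k
    simpa [Matrix.toLpLin_apply] using this
  rw [← hsymm, hev, inner_smul_left, real_inner_comm]
  simp
  ring

lemma norm_sq_eq_sum_inner {n : ℕ} (b : OrthonormalBasis (Fin n) ℝ (Eucl n)) (x : Eucl n) :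
    ‖x‖ ^ 2 = ∑ j, (inner ℝ (b j) x) ^ 2 := by
  rw [← real_inner_self_eq_norm_sq, ← b.sum_inner_mul_inner]
  refine Finset.sum_congr rfl fun j _ => ?_
  rw [real_inner_comm, sq]

/-- Weyl's perturbation inequality. -/
lemma eigenvalues_le_add_of_qf_le {n : ℕ} {A B : Matrix (Fin n) (Fin n) ℝ}
    (hA : A.IsHermitian) (hB : B.IsHermitian) {ε : ℝ}
    (hAB : ∀ x : Eucl n, qf A x x ≤ qf B x x + ε * ‖x‖ ^ 2) (i : Fin n) :
    hA.eigenvalues i ≤ hB.eigenvalues i + ε := by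
  classical
  set e := (Fintype.equivOfCardEq (Fintype.card_fin (Fintype.card (Fin n)))).symm with he
  let L : Eucl n →ₗ[ℝ] ({j : Fin n // j ≠ i} → ℝ) :=
    LinearMap.pi fun j => if e i < e j then (innerₛₗ ℝ (hA.eigenvectorBasis j))
      else (innerₛₗ ℝ (hB.eigenvectorBasis j))
  have hker : LinearMap.ker L ≠ ⊥ := by
    apply LinearMap.ker_ne_bot_of_finrank_lt
    have h0 : 0 < n := i.pos
    simp
    omega
  obtain ⟨x, hx, hx0⟩ := Submodule.exists_mem_ne_zero_of_ne_bot hker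
  have hLx : ∀ j : {j : Fin n // j ≠ i}, L x j = 0 := fun j => by
    rw [LinearMap.mem_ker.mp hx]; rfl
  have hA0 : ∀ j, e i < e j → inner ℝ (hA.eigenvectorBasis j) x = 0 := by
    intro j hj
    have := hLx ⟨j, by rintro rfl; exact lt_irrefl _ hj⟩
    simpa [L, hj] using this
  have hB0 : ∀ j, e j < e i → inner ℝ (hB.eigenvectorBasis j) x = 0 := by
    intro j hj
    have := hLx ⟨j, by rintro rfl; exact lt_irrefl _ hj⟩
    simpa [L, hj.not_gt] using this
  have h1 : hA.eigenvalues i * ‖x‖ ^ 2 ≤ qf A x x := by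
    rw [qf_eq_sum_eigenvalues hA, norm_sq_eq_sum_inner hA.eigenvectorBasis, Finset.mul_sum]
    refine Finset.sum_le_sum fun j _ => ?_
    rcases lt_or_ge (e i) (e j) with hj | hj
    · simp [hA0 j hj]
    · exact mul_le_mul_of_nonneg_right (hA.eigenvalues₀_antitone hj) (sq_nonneg _)
  have h2 : qf B x x ≤ hB.eigenvalues i * ‖x‖ ^ 2 := by
    rw [qf_eq_sum_eigenvalues hB, norm_sq_eq_sum_inner hB.eigenvectorBasis, Finset.mul_sum]
    refine Finset.sum_le_sum fun j _ => ?_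
    rcases lt_or_ge (e j) (e i) with hj | hj
    · simp [hB0 j hj]
    · exact mul_le_mul_of_nonneg_right (hB.eigenvalues₀_antitone hj) (sq_nonneg _)
  have hpos : 0 < ‖x‖ ^ 2 := by positivity
  have h3 := hAB x
  nlinarith

lemma Fop_le_add_of_qf_le {n : ℕ} {A B : Matrix (Fin n) (Fin n) ℝ}
    (hA : A.IsHermitian) (hB : B.IsHermitian) {ε : ℝ} (hε : 0 ≤ ε)
    (hAB : ∀ x : Eucl n, qf A x x ≤ qf B x x + ε * ‖x‖ ^ 2) :
    Fop A ≤ Fop B + n * ε := by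
  have harctan : ∀ a : ℝ, arctan (a + ε) ≤ arctan a + ε := fun a => by
    have hd : ∀ y, deriv arctan y ≤ 1 := fun y => by
      rw [(hasDerivAt_arctan y).deriv]
      rw [div_le_one (by positivity)]
      nlinarith [sq_nonneg y]
    have := image_sub_le_mul_sub_of_deriv_le differentiable_arctan hd (x := a) (y := a + ε)
      (by linarith)
    linarith
  simp only [Fop, eigs, dif_pos hA, dif_pos hB]
  calc ∑ i, arctan (hA.eigenvalues i) ≤ ∑ i, (arctan (hB.eigenvalues i) + ε) :=
        Finset.sum_le_sum fun i _ =>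
          (arctan_strictMono.monotone (eigenvalues_le_add_of_qf_le hA hB hAB i)).trans (harctan _)
    _ = _ := by simp [Finset.sum_add_distrib]

lemma abs_Fop_le {n : ℕ} (A : Matrix (Fin n) (Fin n) ℝ) : |Fop A| ≤ n * (π / 2) := by
  refine (Finset.abs_sum_le_sum_abs _ _).trans ?_
  calc ∑ i, |arctan (eigs A i)| ≤ ∑ _i : Fin n, π / 2 :=
        Finset.sum_le_sum fun i _ => abs_le.mpr
          ⟨(neg_pi_div_two_lt_arctan _).le, (arctan_lt_pi_div_two _).le⟩
    _ = _ := by simp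

/-! ### One-dimensional calculus -/

lemma exists_strictMonoOn_of_deriv_pos_left {φ ψ : ℝ → ℝ} (hφ : ContinuousOn φ (Icc 0 1))
    (hd : ∀ r ∈ Ioo (0 : ℝ) 1, HasDerivAt φ (ψ r) r)
    (hψ : ContinuousWithinAt ψ (Icc 0 1) 0) (h0 : 0 < ψ 0) :
    ∃ δ ∈ Ioc (0 : ℝ) 1, StrictMonoOn φ (Icc 0 δ) := by
  have hev : ∀ᶠ r in 𝓝[Icc 0 1] (0 : ℝ), 0 < ψ r := hψ.eventually (lt_mem_nhds h0)
  obtain ⟨η, hη, hball⟩ := Metric.mem_nhdsWithin_iff.mp hev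
  refine ⟨min (η / 2) 1, ⟨by positivity, min_le_right _ _⟩, ?_⟩
  have hle1 : min (η / 2) 1 ≤ 1 := min_le_right _ _
  have hle2 : min (η / 2) 1 ≤ η / 2 := min_le_left _ _
  refine strictMonoOn_of_deriv_pos (convex_Icc _ _)
    (hφ.mono (Icc_subset_Icc_right hle1)) fun r hr => ?_
  rw [interior_Icc] at hr
  rw [(hd r ⟨hr.1, hr.2.trans_le hle1⟩).deriv]
  refine hball ⟨?_, hr.1.le, hr.2.le.trans hle1⟩
  rw [Metric.mem_ball, Real.dist_eq, sub_zero, abs_of_pos hr.1]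
  linarith [hr.2]

lemma deriv_nonpos_of_max_left {φ ψ : ℝ → ℝ} (hφ : ContinuousOn φ (Icc 0 1))
    (hd : ∀ r ∈ Ioo (0 : ℝ) 1, HasDerivAt φ (ψ r) r)
    (hψ : ContinuousWithinAt ψ (Icc 0 1) 0) (hmax : ∀ r ∈ Icc (0 : ℝ) 1, φ r ≤ φ 0) :
    ψ 0 ≤ 0 := by
  by_contra! h0
  obtain ⟨δ, hδ, hmono⟩ := exists_strictMonoOn_of_deriv_pos_left hφ hd hψ h0
  exact (hmono (left_mem_Icc.mpr hδ.1.le) (right_mem_Icc.mpr hδ.1.le) hδ.1).not_ge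
    (hmax δ ⟨hδ.1.le, hδ.2⟩)

lemma deriv_two_nonpos_of_max_left {φ ψ κ : ℝ → ℝ} (hφ : ContinuousOn φ (Icc 0 1))
    (hd : ∀ r ∈ Ioo (0 : ℝ) 1, HasDerivAt φ (ψ r) r) (hψ : ContinuousOn ψ (Icc 0 1))
    (hd2 : ∀ r ∈ Ioo (0 : ℝ) 1, HasDerivAt ψ (κ r) r)
    (hκ : ContinuousWithinAt κ (Icc 0 1) 0) (hψ0 : ψ 0 = 0)
    (hmax : ∀ r ∈ Icc (0 : ℝ) 1, φ r ≤ φ 0) : κ 0 ≤ 0 := by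
  by_contra! h0
  obtain ⟨δ, hδ, hmono⟩ := exists_strictMonoOn_of_deriv_pos_left hψ hd2 hκ h0
  have hsm : StrictMonoOn φ (Icc 0 δ) := by
    refine strictMonoOn_of_deriv_pos (convex_Icc _ _)
      (hφ.mono (Icc_subset_Icc_right hδ.2)) fun r hr => ?_
    rw [interior_Icc] at hr
    rw [(hd r ⟨hr.1, hr.2.trans_le hδ.2⟩).deriv, ← hψ0]
    exact hmono (left_mem_Icc.mpr hδ.1.le) ⟨hr.1.le, hr.2.le⟩ hr.1
  exact (hsm (left_mem_Icc.mpr hδ.1.le) (right_mem_Icc.mpr hδ.1.le) hδ.1).not_ge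
    (hmax δ ⟨hδ.1.le, hδ.2⟩)

/-! ### Partial derivatives along lines -/

lemma grad_apply {n : ℕ} (g : Eucl n → ℝ) (x : Eucl n) (i : Fin n) : grad g x i = pd i g x := rfl

lemma fderiv_apply_eq_sum {n : ℕ} (L : Eucl n →L[ℝ] ℝ) (e : Eucl n) :
    L e = ∑ i, e i * L (EuclideanSpace.single i 1) := by
  conv_lhs => rw [← (EuclideanSpace.basisFun (Fin n) ℝ).sum_repr e]
  simp

lemma fderiv_eq_inner_grad {n : ℕ} (g : Eucl n → ℝ) (x e : Eucl n) :
    fderiv ℝ g x e = inner ℝ (grad g x) e := by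
  rw [fderiv_apply_eq_sum, PiLp.inner_apply]
  simp [grad_apply, pd]

lemma hasDerivAt_line {n : ℕ} {g : Eucl n → ℝ} {x e : Eucl n} {r : ℝ}
    (hg : DifferentiableAt ℝ g (x + r • e)) :
    HasDerivAt (fun s : ℝ => g (x + s • e)) (inner ℝ (grad g (x + r • e)) e) r := by
  rw [← fderiv_eq_inner_grad]
  have hl : HasDerivAt (fun s : ℝ => x + s • e) e r := by
    simpa using ((hasDerivAt_id r).smul_const e).const_add x
  exact hg.hasFDerivAt.comp_hasDerivAt r hl

lemma hasDerivAt_inner_grad_line {n : ℕ} {g : Eucl n → ℝ} {x e : Eucl n} {r : ℝ}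
    (hg : ∀ j, DifferentiableAt ℝ (pd j g) (x + r • e)) (w : Eucl n) :
    HasDerivAt (fun s : ℝ => inner ℝ (grad g (x + s • e)) w)
      (qf (hess g (x + r • e)) e w) r := by
  have h1 := HasDerivAt.fun_sum (u := Finset.univ)
    fun j (_ : j ∈ Finset.univ) => (hasDerivAt_line (hg j)).mul_const (w j)
  have hf : (fun s : ℝ => inner ℝ (grad g (x + s • e)) w)
      = fun s => ∑ j, pd j g (x + s • e) * w j := by
    ext s
    simp [PiLp.inner_apply, grad_apply, mul_comm]
  have hq : qf (hess g (x + r • e)) e w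
      = ∑ j, inner ℝ (grad (pd j g) (x + r • e)) e * w j := by
    rw [qf, Finset.sum_comm]
    refine Finset.sum_congr rfl fun j _ => ?_
    simp [PiLp.inner_apply, grad_apply, hess, Finset.sum_mul]
  rw [hf, hq]
  exact h1

lemma ContDiffAt.differentiableAt_pd {n : ℕ} {g : Eucl n → ℝ} {x : Eucl n}
    (hg : ContDiffAt ℝ 2 g x) (j : Fin n) : DifferentiableAt ℝ (pd j g) x := by
  have h1 : ContDiffAt ℝ 1 (fderiv ℝ g) x := hg.fderiv_right (by norm_num)
  exact (h1.differentiableAt (by norm_num)).clm_apply (differentiableAt_const _)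

/-! ### Functions of class `C²` up to the boundary -/

/-- `g` is `C²` in `Ω`, and the total derivatives `pd`, `hess` extend those of `g|Ω`
continuously to the closure. -/
structure C2Closure {n : ℕ} (Ω : Set (Eucl n)) (g : Eucl n → ℝ) : Prop where
  contDiffOn : ContDiffOn ℝ 2 g Ω
  cont : ContinuousOn g (closure Ω)
  cont_pd : ∀ i, ContinuousOn (pd i g) (closure Ω)
  cont_hess : ∀ i j, ContinuousOn (fun x => hess g x i j) (closure Ω)

namespace C2Closure

variable {n : ℕ} {Ω : Set (Eucl n)} {a b g : Eucl n → ℝ}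

lemma cont_grad (hg : C2Closure Ω g) : ContinuousOn (grad g) (closure Ω) := by
  refine (EuclideanSpace.equiv (Fin n) ℝ).symm.continuous.comp_continuousOn ?_
  exact continuousOn_pi.mpr hg.cont_pd

lemma cont_qf (hg : C2Closure Ω g) (e w : Eucl n) :
    ContinuousOn (fun x => qf (hess g x) e w) (closure Ω) :=
  continuousOn_finsetSum _ fun i _ => continuousOn_finsetSum _ fun j _ =>
    (continuousOn_const.mul (hg.cont_hess i j)).mul continuousOn_const

lemma contDiffAt (hg : C2Closure Ω g) (hΩ : IsOpen Ω) {x : Eucl n} (hx : x ∈ Ω) :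
    ContDiffAt ℝ 2 g x := hg.contDiffOn.contDiffAt (hΩ.mem_nhds hx)

end C2Closure

lemma NiceDomain.line_mem {n : ℕ} {Ω : Set (Eucl n)} (hΩ : NiceDomain Ω) {x y : Eucl n}
    (hx : x ∈ closure Ω) (hy : y ∈ Ω) {r : ℝ} (hr : r ∈ Ioc (0 : ℝ) 1) :
    x + r • (y - x) ∈ Ω := by
  have := hΩ.convex.add_smul_sub_mem_interior' hx (hΩ.isOpen.interior_eq.symm ▸ hy) hr
  rwa [hΩ.isOpen.interior_eq] at this

lemma NiceDomain.line_mem_closure {n : ℕ} {Ω : Set (Eucl n)} (hΩ : NiceDomain Ω) {x y : Eucl n}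
    (hx : x ∈ closure Ω) (hy : y ∈ closure Ω) {r : ℝ} (hr : r ∈ Icc (0 : ℝ) 1) :
    x + r • (y - x) ∈ closure Ω :=
  hΩ.convex.closure.add_smul_sub_mem hx hy hr

lemma NiceDomain.continuousOn_line {n : ℕ} {Ω : Set (Eucl n)} (hΩ : NiceDomain Ω)
    {F : Eucl n → ℝ} (hF : ContinuousOn F (closure Ω)) {x y : Eucl n}
    (hx : x ∈ closure Ω) (hy : y ∈ closure Ω) :
    ContinuousOn (fun r : ℝ => F (x + r • (y - x))) (Icc 0 1) :=
  hF.comp (by fun_prop) fun _ hr => hΩ.line_mem_closure hx hy hr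

lemma inner_grad_sub_nonpos_of_max {n : ℕ} {Ω : Set (Eucl n)} (hΩ : NiceDomain Ω)
    {a b : Eucl n → ℝ} (ha : C2Closure Ω a) (hb : C2Closure Ω b) {x y : Eucl n}
    (hx : x ∈ closure Ω) (hy : y ∈ Ω)
    (hmax : ∀ z ∈ closure Ω, a z - b z ≤ a x - b x) :
    inner ℝ (grad a x - grad b x) (y - x) ≤ 0 := by
  have hy' := subset_closure hy
  have hdiff : ∀ {g : Eucl n → ℝ}, C2Closure Ω g → ∀ r ∈ Ioo (0 : ℝ) 1,
      DifferentiableAt ℝ g (x + r • (y - x)) := fun hg r hr =>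
    (hg.contDiffAt hΩ.isOpen (hΩ.line_mem hx hy ⟨hr.1, hr.2.le⟩)).differentiableAt (by norm_num)
  have hc : ∀ {g : Eucl n → ℝ}, C2Closure Ω g →
      ContinuousOn (fun r : ℝ => inner ℝ (grad g (x + r • (y - x))) (y - x)) (Icc 0 1) :=
    fun hg => hΩ.continuousOn_line (F := fun z => inner ℝ (grad _ z) (y - x))
      (hg.cont_grad.inner continuousOn_const) hx hy'
  have key := deriv_nonpos_of_max_left
    ((hΩ.continuousOn_line ha.cont hx hy').sub (hΩ.continuousOn_line hb.cont hx hy'))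
    (fun r hr => (hasDerivAt_line (hdiff ha r hr)).sub (hasDerivAt_line (hdiff hb r hr)))
    (((hc ha).sub (hc hb)) 0 (by simp))
    (fun r hr => by simpa using hmax _ (hΩ.line_mem_closure hx hy' hr))
  simpa [inner_sub_left] using key

lemma qf_hess_le_of_max {n : ℕ} {Ω : Set (Eucl n)} (hΩ : NiceDomain Ω)
    {a b : Eucl n → ℝ} (ha : C2Closure Ω a) (hb : C2Closure Ω b) {x y : Eucl n}
    (hx : x ∈ closure Ω) (hy : y ∈ Ω) (hgrad : grad a x = grad b x)
    (hmax : ∀ z ∈ closure Ω, a z - b z ≤ a x - b x) :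
    qf (hess a x) (y - x) (y - x) ≤ qf (hess b x) (y - x) (y - x) := by
  have hy' := subset_closure hy
  have hC : ∀ {g : Eucl n → ℝ}, C2Closure Ω g → ∀ r ∈ Ioo (0 : ℝ) 1,
      ContDiffAt ℝ 2 g (x + r • (y - x)) := fun hg r hr =>
    hg.contDiffAt hΩ.isOpen (hΩ.line_mem hx hy ⟨hr.1, hr.2.le⟩)
  have hc : ∀ {g : Eucl n → ℝ}, C2Closure Ω g →
      ContinuousOn (fun r : ℝ => inner ℝ (grad g (x + r • (y - x))) (y - x)) (Icc 0 1) :=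
    fun hg => hΩ.continuousOn_line (F := fun z => inner ℝ (grad _ z) (y - x))
      (hg.cont_grad.inner continuousOn_const) hx hy'
  have hq : ∀ {g : Eucl n → ℝ}, C2Closure Ω g →
      ContinuousOn (fun r : ℝ => qf (hess g (x + r • (y - x))) (y - x) (y - x)) (Icc 0 1) :=
    fun hg => hΩ.continuousOn_line (hg.cont_qf (y - x) (y - x)) hx hy'
  have key := deriv_two_nonpos_of_max_left
    ((hΩ.continuousOn_line ha.cont hx hy').sub (hΩ.continuousOn_line hb.cont hx hy'))
    (fun r hr => (hasDerivAt_line ((hC ha r hr).differentiableAt (by norm_num))).sub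
      (hasDerivAt_line ((hC hb r hr).differentiableAt (by norm_num))))
    ((hc ha).sub (hc hb))
    (fun r hr => (hasDerivAt_inner_grad_line (fun j => (hC ha r hr).differentiableAt_pd j) _).sub
      (hasDerivAt_inner_grad_line (fun j => (hC hb r hr).differentiableAt_pd j) _))
    (((hq ha).sub (hq hb)) 0 (by simp)) (by simp [hgrad])
    (fun r hr => by simpa using hmax _ (hΩ.line_mem_closure hx hy' hr))
  simpa using key

lemma qf_pos {n : ℕ} {A : Matrix (Fin n) (Fin n) ℝ} (hA : A.PosDef) {e : Eucl n} (he : e ≠ 0) :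
    0 < qf A e e := by
  rw [qf_eq_dotProduct]
  have : (e : Fin n → ℝ) ≠ 0 := fun h0 => he (by ext i; exact congrFun h0 i)
  simpa using hA.dotProduct_mulVec_pos this

/-- Strict monotonicity of the gradient of a strictly convex function. -/
lemma inner_grad_lt_of_posDef {n : ℕ} {Ω : Set (Eucl n)} (hΩ : NiceDomain Ω)
    {g : Eucl n → ℝ} (hg : C2Closure Ω g) (hpos : ∀ x ∈ Ω, (hess g x).PosDef) {x y : Eucl n}
    (hx : x ∈ closure Ω) (hy : y ∈ Ω) (hxy : y ≠ x) :
    inner ℝ (grad g x) (y - x) < inner ℝ (grad g y) (y - x) := by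
  have hsm : StrictMonoOn (fun r : ℝ => inner ℝ (grad g (x + r • (y - x))) (y - x))
      (Icc 0 1) := by
    refine strictMonoOn_of_deriv_pos (convex_Icc _ _)
      (hΩ.continuousOn_line (F := fun z => inner ℝ (grad g z) (y - x))
        (hg.cont_grad.inner continuousOn_const) hx (subset_closure hy)) fun r hr => ?_
    rw [interior_Icc] at hr
    have hmem := hΩ.line_mem hx hy ⟨hr.1, hr.2.le⟩
    rw [(hasDerivAt_inner_grad_line
      (fun j => (hg.contDiffAt hΩ.isOpen hmem).differentiableAt_pd j) _).deriv]
    exact qf_pos (hpos _ hmem) (sub_ne_zero.mpr hxy)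
  simpa using hsm (left_mem_Icc.mpr zero_le_one) (right_mem_Icc.mpr zero_le_one) zero_lt_one

/-! ### Defining functions -/

lemma ContDiff.continuous_pd {n : ℕ} {g : Eucl n → ℝ} (hg : ContDiff ℝ 2 g) (j : Fin n) :
    Continuous (pd j g) :=
  (hg.continuous_fderiv (by norm_num)).clm_apply continuous_const

lemma ContDiff.continuous_grad {n : ℕ} {g : Eucl n → ℝ} (hg : ContDiff ℝ 2 g) :
    Continuous (grad g) :=
  (EuclideanSpace.equiv (Fin n) ℝ).symm.continuous.comp (continuous_pi hg.continuous_pd)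

lemma ContDiff.continuous_hess {n : ℕ} {g : Eucl n → ℝ} (hg : ContDiff ℝ 2 g) (i j : Fin n) :
    Continuous (fun x => hess g x i j) := by
  have h1 : ContDiff ℝ 1 (fderiv ℝ g) := hg.fderiv_right (by norm_num)
  have h2 : ContDiff ℝ 1 (pd j g) := h1.clm_apply contDiff_const
  exact (h2.continuous_fderiv (by norm_num)).clm_apply continuous_const

lemma ContDiff.c2Closure {n : ℕ} {g : Eucl n → ℝ} (hg : ContDiff ℝ 2 g) (Ω : Set (Eucl n)) :
    C2Closure Ω g where
  contDiffOn := hg.contDiffOn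
  cont := hg.continuous.continuousOn
  cont_pd i := (hg.continuous_pd i).continuousOn
  cont_hess i j := (hg.continuous_hess i j).continuousOn

lemma qf_neg_smul_one_sub {n : ℕ} (A : Matrix (Fin n) (Fin n) ℝ) (c : ℝ) (e : Eucl n) :
    qf (-(c • (1 : Matrix (Fin n) (Fin n) ℝ)) - A) e e = -(c * ‖e‖ ^ 2) - qf A e e := by
  rw [qf_eq_dotProduct, qf_eq_dotProduct, Matrix.sub_mulVec, dotProduct_sub, Matrix.neg_mulVec,
    Matrix.smul_mulVec, Matrix.one_mulVec, dotProduct_neg, dotProduct_smul,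
    EuclideanSpace.real_norm_sq_eq]
  simp [dotProduct, sq]

namespace DefFn

variable {n : ℕ} {Ω : Set (Eucl n)} {h : Eucl n → ℝ} {θ Θ : ℝ}

lemma contDiff_two (hd : DefFn Ω h θ Θ) : ContDiff ℝ 2 h :=
  contDiff_infty.mp hd.smooth 2

lemma mem_iff (hd : DefFn Ω h θ Θ) {x : Eucl n} : x ∈ Ω ↔ 0 < h x := by
  conv_lhs => rw [hd.domain_eq]
  rfl

lemma isOpen (hd : DefFn Ω h θ Θ) : IsOpen Ω := by
  rw [hd.domain_eq]
  exact isOpen_lt continuous_const hd.smooth.continuous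

lemma nonneg_of_mem_closure_s5 (hd : DefFn Ω h θ Θ) {x : Eucl n} (hx : x ∈ closure Ω) :
    0 ≤ h x :=
  closure_minimal (fun _ hy => (hd.mem_iff.mp hy).le)
    (isClosed_le continuous_const hd.smooth.continuous) hx

lemma mem_frontier (hd : DefFn Ω h θ Θ) {x : Eucl n} (hx : x ∈ closure Ω) (h0 : h x = 0) :
    x ∈ frontier Ω := by
  rw [hd.isOpen.frontier_eq]
  exact ⟨hx, fun hm => (hd.mem_iff.mp hm).ne' h0⟩

lemma mem_or_frontier (hd : DefFn Ω h θ Θ) {x : Eucl n} (hx : x ∈ closure Ω) :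
    x ∈ Ω ∨ (x ∈ frontier Ω ∧ h x = 0) := by
  rcases (hd.nonneg_of_mem_closure_s5 hx).lt_or_eq with h0 | h0
  · exact Or.inl (hd.mem_iff.mpr h0)
  · exact Or.inr ⟨hd.mem_frontier hx h0.symm, h0.symm⟩

lemma qf_hess_le (hd : DefFn Ω h θ Θ) {x : Eucl n} (hx : x ∈ closure Ω) (e : Eucl n) :
    qf (hess h x) e e ≤ -(θ * ‖e‖ ^ 2) := by
  have hcont : Continuous fun x => qf (hess h x) e e := by
    have := (hd.contDiff_two.c2Closure univ).cont_qf e e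
    rwa [closure_univ, continuousOn_univ] at this
  refine closure_minimal (fun y hy => ?_) (isClosed_le hcont continuous_const) hx
  have := (hd.hess_upper y hy).dotProduct_mulVec_nonneg e
  rw [star_trivial, ← qf_eq_dotProduct, qf_neg_smul_one_sub] at this
  change qf (hess h y) e e ≤ _
  linarith

/-- Strict concavity: the gradient at a zero of `h` in the closure points into the domain. -/
lemma inner_grad_pos (hd : DefFn Ω h θ Θ) (hΩ : NiceDomain Ω) {p y : Eucl n}
    (hp : p ∈ closure Ω) (hp0 : h p = 0) (hy : y ∈ closure Ω) (hne : y ≠ p) :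
    0 < inner ℝ (grad h p) (y - p) := by
  by_contra! hle
  have hC : ∀ z, ContDiffAt ℝ 2 h z := fun z => hd.contDiff_two.contDiffAt
  have hd1 : ∀ r : ℝ, HasDerivAt (fun s : ℝ => h (p + s • (y - p)))
      (inner ℝ (grad h (p + r • (y - p))) (y - p)) r := fun r =>
    hasDerivAt_line ((hC _).differentiableAt (by norm_num))
  have hd2 : ∀ r : ℝ, HasDerivAt (fun s : ℝ => inner ℝ (grad h (p + s • (y - p))) (y - p))
      (qf (hess h (p + r • (y - p))) (y - p) (y - p)) r := fun r =>
    hasDerivAt_inner_grad_line (fun j => (hC _).differentiableAt_pd j) _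
  have hpos : 0 < θ * ‖y - p‖ ^ 2 :=
    mul_pos hd.theta_pos (pow_pos (norm_pos_iff.mpr (sub_ne_zero.mpr hne)) 2)
  have hanti : StrictAntiOn (fun s : ℝ => inner ℝ (grad h (p + s • (y - p))) (y - p))
      (Icc 0 1) := by
    refine strictAntiOn_of_deriv_neg (convex_Icc _ _)
      (fun r _ => (hd2 r).continuousAt.continuousWithinAt) fun r hr => ?_
    rw [(hd2 r).deriv]
    have := hd.qf_hess_le (hΩ.line_mem_closure hp hy (interior_subset hr)) (y - p)
    linarith
  have hanti' : StrictAntiOn (fun s : ℝ => h (p + s • (y - p))) (Icc 0 1) := by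
    refine strictAntiOn_of_deriv_neg (convex_Icc _ _)
      (fun r _ => (hd1 r).continuousAt.continuousWithinAt) fun r hr => ?_
    rw [(hd1 r).deriv]
    rw [interior_Icc] at hr
    have := hanti (left_mem_Icc.mpr zero_le_one) (Ioo_subset_Icc_self hr) hr.1
    simp only [zero_smul, add_zero] at this
    linarith
  have := hanti' (left_mem_Icc.mpr zero_le_one) (right_mem_Icc.mpr zero_le_one) zero_lt_one
  simp only [zero_smul, add_zero, one_smul, add_sub_cancel] at this
  linarith [hd.nonneg_of_mem_closure_s5 hy]

/-- Directions with positive inner product with the gradient enter the domain. -/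
lemma eventually_line_mem (hd : DefFn Ω h θ Θ) {p e : Eucl n} (hp0 : h p = 0)
    (he : 0 < inner ℝ (grad h p) e) : ∀ᶠ r in 𝓝[>] (0 : ℝ), p + r • e ∈ Ω := by
  have hd1 : HasDerivAt (fun s : ℝ => h (p + s • e)) (inner ℝ (grad h (p + (0 : ℝ) • e)) e) 0 :=
    hasDerivAt_line (hd.contDiff_two.contDiffAt.differentiableAt (by norm_num))
  rw [zero_smul, add_zero] at hd1
  have hslope := (hasDerivAt_iff_tendsto_slope.mp hd1).mono_left
    (nhdsWithin_mono (0 : ℝ) (fun r (hr : 0 < r) => hr.ne'))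
  filter_upwards [hslope.eventually (lt_mem_nhds he), self_mem_nhdsWithin] with r hr hr0
  rw [slope_def_field] at hr
  simp only [zero_smul, add_zero, hp0, sub_zero] at hr
  exact hd.mem_iff.mpr ((div_pos_iff_of_pos_right hr0).mp hr)

lemma mem_closure_of_grad_ne_zero (hd : DefFn Ω h θ Θ) {p : Eucl n} (hp0 : h p = 0)
    (hg : grad h p ≠ 0) : p ∈ closure Ω := by
  have hev := hd.eventually_line_mem hp0 (real_inner_self_pos.mpr hg)
  refine mem_closure_of_tendsto (b := 𝓝[>] (0 : ℝ)) (f := fun r : ℝ => p + r • grad h p) ?_ hev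
  have : Tendsto (fun r : ℝ => p + r • grad h p) (𝓝 0) (𝓝 (p + (0 : ℝ) • grad h p)) :=
    Continuous.tendsto (by fun_prop) 0
  rw [zero_smul, add_zero] at this
  exact this.mono_left nhdsWithin_le_nhds

lemma grad_ne_zero (hd : DefFn Ω h θ Θ) {p : Eucl n} (hp : p ∈ closure Ω) (hp0 : h p = 0) :
    grad h p ≠ 0 := by
  intro h0
  have := hd.grad_unit p (hd.mem_frontier hp hp0)
  simp [h0] at this

/-- The zero set of `h` agrees with the closure of the domain near its boundary. -/
lemma eventually_mem_closure (hd : DefFn Ω h θ Θ) {p : Eucl n} (hp : p ∈ closure Ω)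
    (hp0 : h p = 0) : ∀ᶠ z in 𝓝 p, h z = 0 → z ∈ closure Ω := by
  filter_upwards [hd.contDiff_two.continuous_grad.continuousAt.eventually_ne
    (hd.grad_ne_zero hp hp0)] with z hz hz0
  exact hd.mem_closure_of_grad_ne_zero hz0 hz

end DefFn

/-! ### Gradient image and boundary maxima -/

/-- For strictly convex `g`, a convex closed set containing the gradient on the boundary contains
it everywhere. -/
lemma grad_mem_closure_of_frontier {n : ℕ} {Ω K : Set (Eucl n)} (hΩ : NiceDomain Ω)
    (hK : Convex ℝ K) (hKne : K.Nonempty) {g : Eucl n → ℝ} (hg : C2Closure Ω g)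
    (hpos : ∀ x ∈ Ω, (hess g x).PosDef)
    (hfr : ∀ x ∈ frontier Ω, grad g x ∈ closure K) {x : Eucl n} (hx : x ∈ closure Ω) :
    grad g x ∈ closure K := by
  by_contra hnot
  obtain ⟨ℓ, s, hs, hsx⟩ := geometric_hahn_banach_closed_point hK.closure isClosed_closure hnot
  set w : Eucl n := (InnerProductSpace.toDual ℝ (Eucl n)).symm ℓ with hw
  have hℓ : ∀ z, ℓ z = inner ℝ z w := fun z => by
    rw [real_inner_comm, hw, InnerProductSpace.toDual_symm_apply]
  have hcompact : IsCompact (closure Ω) := hΩ.bounded.isCompact_closure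
  obtain ⟨z, hz, hzmax⟩ := hcompact.exists_isMaxOn ⟨x, hx⟩
    (hg.cont_grad.inner (𝕜 := ℝ) (continuousOn_const (c := w)))
  have hzx : s < inner ℝ (grad g z) w := by
    rw [hℓ] at hsx
    exact hsx.trans_le (hzmax hx)
  have hzΩ : z ∈ Ω := by
    by_contra hz'
    have := hs _ (hfr z (by rw [hΩ.isOpen.frontier_eq]; exact ⟨hz, hz'⟩))
    rw [hℓ] at this
    exact lt_asymm this hzx
  have hw0 : w ≠ 0 := by
    intro h0
    obtain ⟨k, hk⟩ := hKne
    have := hs k (subset_closure hk)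
    rw [hℓ, h0, inner_zero_right] at this hsx
    exact lt_asymm this hsx
  have hderiv : HasDerivAt (fun r : ℝ => inner ℝ (grad g (z + r • w)) w)
      (qf (hess g (z + (0 : ℝ) • w)) w w) 0 :=
    hasDerivAt_inner_grad_line (fun j => by
      rw [zero_smul, add_zero]
      exact (hg.contDiffAt hΩ.isOpen hzΩ).differentiableAt_pd j) _
  rw [zero_smul, add_zero] at hderiv
  have hlocal : IsLocalMax (fun r : ℝ => inner ℝ (grad g (z + r • w)) w) 0 := by
    have hcont : ContinuousAt (fun r : ℝ => z + r • w) 0 := by fun_prop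
    have hmem : ∀ᶠ r : ℝ in 𝓝 0, z + r • w ∈ Ω :=
      hcont.eventually (hΩ.isOpen.mem_nhds (by simpa using hzΩ))
    filter_upwards [hmem] with r hr
    simpa using hzmax (subset_closure hr)
  exact (qf_pos (hpos z hzΩ) hw0).ne' (hlocal.hasDerivAt_eq_zero hderiv)

lemma qf_smul {n : ℕ} (A : Matrix (Fin n) (Fin n) ℝ) (r : ℝ) (e : Eucl n) :
    qf A (r • e) (r • e) = r ^ 2 * qf A e e := by
  rw [qf_eq_inner, qf_eq_inner, map_smul, inner_smul_left, inner_smul_right]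
  simp
  ring

lemma continuous_qf {n : ℕ} (A : Matrix (Fin n) (Fin n) ℝ) :
    Continuous fun e : Eucl n => qf A e e := by
  unfold qf
  fun_prop

/-- Every direction `e` enters an open set from an interior point. -/
lemma IsOpen.exists_line_mem {n : ℕ} {Ω : Set (Eucl n)} (hΩ : IsOpen Ω) {x : Eucl n}
    (hx : x ∈ Ω) (e : Eucl n) : ∃ r > (0 : ℝ), x + r • e ∈ Ω := by
  have hcont : ContinuousAt (fun r : ℝ => x + r • e) 0 := by fun_prop
  have hmem : ∀ᶠ r : ℝ in 𝓝 0, x + r • e ∈ Ω :=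
    hcont.eventually (hΩ.mem_nhds (by simpa using hx))
  obtain ⟨r, hr, hr0⟩ := ((hmem.filter_mono nhdsWithin_le_nhds).and
    (self_mem_nhdsWithin (s := Ioi (0 : ℝ)))).exists
  exact ⟨r, hr0, hr⟩

lemma DefFn.exists_line_mem {n : ℕ} {Ω : Set (Eucl n)} {h : Eucl n → ℝ} {θ Θ : ℝ}
    (hd : DefFn Ω h θ Θ) {p e : Eucl n} (hp0 : h p = 0) (he : 0 < inner ℝ (grad h p) e) :
    ∃ r > (0 : ℝ), p + r • e ∈ Ω := by
  obtain ⟨r, hr, hr0⟩ := ((hd.eventually_line_mem hp0 he).and self_mem_nhdsWithin).exists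
  exact ⟨r, hr0, hr⟩

/-- At a maximum of `a - b` the gradients agree, even on the boundary, provided both gradients
satisfy the second boundary condition for a strictly convex target. -/
lemma grad_eq_of_max {n : ℕ} {Ω Ω' : Set (Eucl n)} {h ht : Eucl n → ℝ} {θ Θ θt Θt : ℝ}
    (hΩ : NiceDomain Ω) (hΩ' : NiceDomain Ω') (hh : DefFn Ω' h θ Θ) (hht : DefFn Ω ht θt Θt)
    {a b : Eucl n → ℝ} (ha : C2Closure Ω a) (hb : C2Closure Ω b)
    (hbpos : ∀ x ∈ Ω, (hess b x).PosDef)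
    (haK : ∀ x ∈ closure Ω, grad a x ∈ closure Ω') (hbK : ∀ x ∈ closure Ω, grad b x ∈ closure Ω')
    (hb0 : ∀ x ∈ frontier Ω, h (grad b x) = 0) {x : Eucl n} (hx : x ∈ closure Ω)
    (hmax : ∀ z ∈ closure Ω, a z - b z ≤ a x - b x) : grad a x = grad b x := by
  set q := grad a x - grad b x with hq
  have hfirst : ∀ e : Eucl n, (∃ r > (0 : ℝ), x + r • e ∈ Ω) → inner ℝ q e ≤ 0 := by
    rintro e ⟨r, hr, hmem⟩
    have := inner_grad_sub_nonpos_of_max hΩ ha hb hx hmem hmax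
    rw [add_sub_cancel_left, inner_smul_right] at this
    exact nonpos_of_mul_nonpos_right this hr
  by_contra hne
  have hq0 : q ≠ 0 := sub_ne_zero.mpr hne
  rcases hht.mem_or_frontier hx with hxΩ | ⟨hxfr, hx0⟩
  · exact (hfirst q (hΩ.isOpen.exists_line_mem hxΩ q)).not_gt (real_inner_self_pos.mpr hq0)
  set D := grad h (grad b x) with hD
  set d := grad ht x with hd
  have hDq : 0 < inner ℝ q D := by
    rw [real_inner_comm]
    exact hh.inner_grad_pos hΩ' (hbK x hx) (hb0 x hxfr) (haK x hx) hne
  have hdd : 0 < inner ℝ d d := real_inner_self_pos.mpr (hht.grad_ne_zero hx hx0)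
  have hdD : inner ℝ d D < 0 := by
    obtain ⟨η, hη, hη0⟩ : ∃ η : ℝ, 0 < inner ℝ q D + η * inner ℝ q d ∧ 0 < η := by
      have hc : ContinuousAt (fun η : ℝ => inner ℝ q D + η * inner ℝ q d) 0 := by fun_prop
      have := hc.eventually (lt_mem_nhds (a := 0) (by simpa using hDq))
      exact ((this.filter_mono nhdsWithin_le_nhds).and
        (self_mem_nhdsWithin (s := Ioi (0 : ℝ)))).exists
    by_contra! hge
    have := hfirst (D + η • d) (hht.exists_line_mem hx0 (by
      rw [inner_add_right, inner_smul_right]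
      exact add_pos_of_nonneg_of_pos hge (mul_pos hη0 hdd)))
    rw [inner_add_right, inner_smul_right] at this
    linarith
  obtain ⟨r, hr, hmem⟩ := hht.exists_line_mem (e := -D) hx0 (by rw [inner_neg_right]; linarith)
  have hD0 : D ≠ 0 := by
    rintro h0
    simp [h0] at hDq
  have hlt := inner_grad_lt_of_posDef hΩ hb hbpos hx hmem (by simpa using ⟨hr.ne', hD0⟩)
  rw [add_sub_cancel_left, inner_smul_right, inner_smul_right, mul_lt_mul_iff_right₀ hr,
    inner_neg_right, inner_neg_right, neg_lt_neg_iff] at hlt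
  have hgt : grad b (x + r • -D) ≠ grad b x := by
    intro h0
    rw [h0] at hlt
    exact lt_irrefl _ hlt
  have := hh.inner_grad_pos hΩ' (hbK x hx) (hb0 x hxfr) (hbK _ (subset_closure hmem)) hgt
  rw [← hD, inner_sub_right, real_inner_comm, real_inner_comm (grad b x)] at this
  linarith

/-- At a maximum of `a - b` where the gradients agree, the Hessians are ordered, even on the
boundary. -/
lemma qf_hess_le_of_max_of_defFn {n : ℕ} {Ω : Set (Eucl n)} {ht : Eucl n → ℝ} {θt Θt : ℝ}
    (hΩ : NiceDomain Ω) (hht : DefFn Ω ht θt Θt)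
    {a b : Eucl n → ℝ} (ha : C2Closure Ω a) (hb : C2Closure Ω b) {x : Eucl n}
    (hx : x ∈ closure Ω) (hgrad : grad a x = grad b x)
    (hmax : ∀ z ∈ closure Ω, a z - b z ≤ a x - b x) (e : Eucl n) :
    qf (hess a x) e e ≤ qf (hess b x) e e := by
  have hcone : ∀ e : Eucl n, (∃ r > (0 : ℝ), x + r • e ∈ Ω) →
      qf (hess a x) e e ≤ qf (hess b x) e e := by
    rintro e ⟨r, hr, hmem⟩
    have := qf_hess_le_of_max hΩ ha hb hx hmem hgrad hmax
    rw [add_sub_cancel_left, qf_smul, qf_smul] at this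
    exact le_of_mul_le_mul_left this (by positivity)
  rcases hht.mem_or_frontier hx with hxΩ | ⟨-, hx0⟩
  · exact hcone e (hΩ.isOpen.exists_line_mem hxΩ e)
  set d := grad ht x with hd
  have hdd : 0 < inner ℝ d d := real_inner_self_pos.mpr (hht.grad_ne_zero hx hx0)
  have hneg : ∀ (A : Matrix (Fin n) (Fin n) ℝ) (e : Eucl n), qf A (-e) (-e) = qf A e e :=
    fun A e => by simpa using qf_smul A (-1) e
  rcases lt_trichotomy (inner ℝ d e) 0 with hlt | heq | hgt
  · rw [← hneg _ e, ← hneg (hess b x) e]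
    exact hcone _ (hht.exists_line_mem hx0 (by rw [inner_neg_right]; linarith))
  · have hlim : ∀ A : Matrix (Fin n) (Fin n) ℝ,
        Tendsto (fun η : ℝ => qf A (e + η • d) (e + η • d)) (𝓝[>] 0) (𝓝 (qf A e e)) := by
      intro A
      have hc : Continuous fun η : ℝ => qf A (e + η • d) (e + η • d) :=
        (continuous_qf A).comp (by fun_prop)
      have := hc.tendsto 0
      rw [zero_smul, add_zero] at this
      exact this.mono_left nhdsWithin_le_nhds
    refine le_of_tendsto_of_tendsto (hlim _) (hlim _) ?_
    filter_upwards [self_mem_nhdsWithin] with η hη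
    refine hcone _ (hht.exists_line_mem hx0 ?_)
    rw [inner_add_right, inner_smul_right, ← hd, heq, zero_add]
    exact mul_pos hη hdd
  · exact hcone e (hht.exists_line_mem hx0 hgt)

/-! ### Limits of `F` -/

lemma qf_le_sum_abs {n : ℕ} (M : Matrix (Fin n) (Fin n) ℝ) (e : Eucl n) :
    qf M e e ≤ (∑ i, ∑ j, |M i j|) * ‖e‖ ^ 2 := by
  rw [qf, Finset.sum_mul]
  refine Finset.sum_le_sum fun i _ => ?_
  rw [Finset.sum_mul]
  refine Finset.sum_le_sum fun j _ => (le_abs_self _).trans ?_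
  have hi : |e i| ≤ ‖e‖ := by simpa using PiLp.norm_apply_le e i
  have hj : |e j| ≤ ‖e‖ := by simpa using PiLp.norm_apply_le e j
  rw [abs_mul, abs_mul]
  calc |e i| * |M i j| * |e j| = |M i j| * (|e i| * |e j|) := by ring
    _ ≤ |M i j| * (‖e‖ * ‖e‖) := by gcongr
    _ = _ := by ring

lemma qf_sub {n : ℕ} (A B : Matrix (Fin n) (Fin n) ℝ) (e : Eucl n) :
    qf (A - B) e e = qf A e e - qf B e e := by
  simp only [qf_eq_dotProduct, Matrix.sub_mulVec, dotProduct_sub]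

lemma eventually_Fop_le {n : ℕ} {X : Type*} {l : Filter X}
    {A B : X → Matrix (Fin n) (Fin n) ℝ} {A₀ B₀ : Matrix (Fin n) (Fin n) ℝ}
    (hAh : ∀ᶠ y in l, (A y).IsHermitian) (hBh : ∀ᶠ y in l, (B y).IsHermitian)
    (hA : ∀ i j, Tendsto (fun y => A y i j) l (𝓝 (A₀ i j)))
    (hB : ∀ i j, Tendsto (fun y => B y i j) l (𝓝 (B₀ i j)))
    (hAB : ∀ e : Eucl n, qf A₀ e e ≤ qf B₀ e e) {ε : ℝ} (hε : 0 < ε) :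
    ∀ᶠ y in l, Fop (A y) ≤ Fop (B y) + ε := by
  set m : X → ℝ := fun y => ∑ i, ∑ j, |((A y - A₀) - (B y - B₀)) i j| with hm
  have hm0 : Tendsto (fun y => n * m y) l (𝓝 0) := by
    have : Tendsto (fun y => n * m y) l (𝓝 (n * ∑ i : Fin n, ∑ j : Fin n,
        |((A₀ i j - A₀ i j) - (B₀ i j - B₀ i j))|)) := by
      refine Tendsto.const_mul _ (tendsto_finsetSum _ fun i _ => tendsto_finsetSum _ fun j _ => ?_)
      exact (((hA i j).sub_const _).sub ((hB i j).sub_const _)).abs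
    simpa using this
  filter_upwards [hAh, hBh, hm0.eventually (gt_mem_nhds hε)] with y hy1 hy2 hy3
  have hmy : 0 ≤ m y := Finset.sum_nonneg fun i _ => Finset.sum_nonneg fun j _ => abs_nonneg _
  refine (Fop_le_add_of_qf_le hy1 hy2 hmy fun e => ?_).trans (by linarith)
  have h1 := qf_le_sum_abs ((A y - A₀) - (B y - B₀)) e
  rw [qf_sub, qf_sub, qf_sub] at h1
  linarith [hAB e]

/-! ### The initial datum -/

namespace InitData

variable {n : ℕ} {Ω Ω' : Set (Eucl n)} {α : NNReal} {u₀ : Eucl n → ℝ}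

lemma hess_isHermitian (hu₀ : InitData Ω Ω' α u₀) {x : Eucl n} (hx : x ∈ closure Ω) :
    (hess u₀ x).IsHermitian := by
  obtain ⟨c, -, hc⟩ := hu₀.uconv
  have h1 := (hc x hx).isHermitian
  have h2 : (c • (1 : Matrix (Fin n) (Fin n) ℝ)).IsHermitian := by
    simp [Matrix.IsHermitian]
  simpa using h1.add h2

/-- Uniform convexity makes the diagonal second derivatives nonzero, so the partial derivatives
are differentiable at every point of the closure. -/
lemma differentiableAt_pd (hu₀ : InitData Ω Ω' α u₀) {x : Eucl n} (hx : x ∈ closure Ω)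
    (i : Fin n) : DifferentiableAt ℝ (pd i u₀) x := by
  obtain ⟨c, hc0, hc⟩ := hu₀.uconv
  have h1 := (hc x hx).diag_nonneg (i := i)
  by_contra hnd
  have h2 : hess u₀ x i i = 0 := by
    simp [hess, pd, fderiv_zero_of_not_differentiableAt hnd]
  simp [h2] at h1
  linarith

lemma continuousOn_grad (hu₀ : InitData Ω Ω' α u₀) : ContinuousOn (grad u₀) (closure Ω) := by
  refine (EuclideanSpace.equiv (Fin n) ℝ).symm.continuous.comp_continuousOn ?_
  exact continuousOn_pi.mpr fun i x hx =>
    (hu₀.differentiableAt_pd hx i).continuousAt.continuousWithinAt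

lemma grad_mem_closure (hu₀ : InitData Ω Ω' α u₀) {x : Eucl n} (hx : x ∈ closure Ω) :
    grad u₀ x ∈ closure Ω' := by
  have hmaps : MapsTo (grad u₀) Ω Ω' := fun y hy => hu₀.grad_onto ▸ mem_image_of_mem _ hy
  exact hmaps.closure_of_continuousOn hu₀.continuousOn_grad hx

end InitData

lemma MemA.continuousOn_comp {n : ℕ} {Ω Ω' : Set (Eucl n)} {f : Eucl n → Eucl n → ℝ}
    (hf : MemA Ω Ω' f) {X : Type*} [TopologicalSpace X] {s : Set X} {g k : X → Eucl n}
    (hg : ContinuousOn g s) (hk : ContinuousOn k s) (hgm : MapsTo g s (closure Ω))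
    (hkm : MapsTo k s (closure Ω')) : ContinuousOn (fun y => f (g y) (k y)) s :=
  hf.reg.continuousOn.comp (hg.prodMk hk) fun _ hy => ⟨hgm hy, hkm hy⟩

/-! ### Regularity of the flow -/

lemma pd_congr {n : ℕ} {g k : Eucl n → ℝ} {x : Eucl n} (h : g =ᶠ[𝓝 x] k) (i : Fin n) :
    pd i g =ᶠ[𝓝 x] pd i k := by
  filter_upwards [h.fderiv (𝕜 := ℝ)] with y hy
  simp [pd, hy]

namespace FlowSol

variable {n : ℕ} {Ω Ω' : Set (Eucl n)} {h ht : Eucl n → ℝ} {θ Θ θt Θt : ℝ} {α : NNReal}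
  {u₀ : Eucl n → ℝ} {f : Eucl n → Eucl n → ℝ} {T : ℝ} {u : Eucl n → ℝ → ℝ}

lemma c2Closure (hu : FlowSol Ω h f u₀ T u) {t : ℝ} (htT : t ∈ Ioc 0 T) :
    C2Closure Ω fun y => u y t := by
  have hslice : ContinuousOn (fun y : Eucl n => (y, t)) (closure Ω) := by fun_prop
  have hmaps : MapsTo (fun y : Eucl n => (y, t)) (closure Ω) (closure Ω ×ˢ Icc 0 T) :=
    fun y hy => ⟨hy, Ioc_subset_Icc_self htT⟩
  exact ⟨(hu.regx t htT).of_le (by norm_num), hu.cont.comp hslice hmaps,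
    fun i => (hu.cont_pd i).comp hslice hmaps, fun i j => (hu.cont_hess i j).comp hslice hmaps⟩

lemma continuousOn_grad (hu : FlowSol Ω h f u₀ T u) :
    ContinuousOn (fun q : Eucl n × ℝ => grad (fun y => u y q.2) q.1) (closure Ω ×ˢ Icc 0 T) := by
  refine (EuclideanSpace.equiv (Fin n) ℝ).symm.continuous.comp_continuousOn ?_
  exact continuousOn_pi.mpr hu.cont_pd

lemma continuousOn_time {X : Type*} [TopologicalSpace X] {F : Eucl n × ℝ → X}
    (hF : ContinuousOn F (closure Ω ×ˢ Icc 0 T)) {x : Eucl n} (hx : x ∈ closure Ω) :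
    ContinuousOn (fun t => F (x, t)) (Icc 0 T) :=
  hF.comp (by fun_prop) fun _ ht => ⟨hx, ht⟩

lemma continuousOn_space {X : Type*} [TopologicalSpace X] {F : Eucl n × ℝ → X}
    (hF : ContinuousOn F (closure Ω ×ˢ Icc 0 T)) {t : ℝ} (ht : t ∈ Icc 0 T) :
    ContinuousOn (fun x => F (x, t)) (closure Ω) :=
  hF.comp (by fun_prop) fun _ hx => ⟨hx, ht⟩

lemma eventuallyEq_init (hu : FlowSol Ω h f u₀ T u) (hΩ : IsOpen Ω) {x : Eucl n} (hx : x ∈ Ω) :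
    (fun y => u y 0) =ᶠ[𝓝 x] u₀ := by
  filter_upwards [hΩ.mem_nhds hx] with y hy
  exact hu.init y (subset_closure hy)

lemma grad_init (hu : FlowSol Ω h f u₀ T u) (hΩ : IsOpen Ω) {x : Eucl n} (hx : x ∈ Ω) :
    grad (fun y => u y 0) x = grad u₀ x := by
  ext i
  exact (pd_congr (hu.eventuallyEq_init hΩ hx) i).eq_of_nhds

lemma hess_init (hu : FlowSol Ω h f u₀ T u) (hΩ : IsOpen Ω) {x : Eucl n} (hx : x ∈ Ω) :
    hess (fun y => u y 0) x = hess u₀ x := by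
  ext i j
  exact (pd_congr (pd_congr (hu.eventuallyEq_init hΩ hx) j) i).eq_of_nhds

lemma grad_zero_mem_closure (hu : FlowSol Ω h f u₀ T u) (hΩ : IsOpen Ω)
    (hu₀ : InitData Ω Ω' α u₀) (hT : 0 < T) {x : Eucl n} (hx : x ∈ closure Ω) :
    grad (fun y => u y 0) x ∈ closure Ω' := by
  have hmaps : MapsTo (grad fun y => u y 0) Ω Ω' := fun y hy => by
    rw [hu.grad_init hΩ hy, ← hu₀.grad_onto]
    exact mem_image_of_mem _ hy
  exact hmaps.closure_of_continuousOn
    (continuousOn_space hu.continuousOn_grad (left_mem_Icc.mpr hT.le)) hx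

lemma h_grad_eq_zero (hu : FlowSol Ω h f u₀ T u) (hh : DefFn Ω' h θ Θ) (hT : 0 < T)
    {x : Eucl n} (hx : x ∈ frontier Ω) {t : ℝ} (htT : t ∈ Icc 0 T) :
    h (grad (fun y => u y t) x) = 0 := by
  have hcont : ContinuousOn (fun s => h (grad (fun y => u y s) x)) (closure (Ioc 0 T)) := by
    rw [closure_Ioc hT.ne]
    exact hh.smooth.continuous.comp_continuousOn
      (continuousOn_time hu.continuousOn_grad (frontier_subset_closure hx))
  rw [← closure_Ioc hT.ne] at htT
  exact le_antisymm
    (le_on_closure (fun s hs => (hu.bdry s hs x hx).le) hcont continuousOn_const htT)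
    (le_on_closure (fun s hs => (hu.bdry s hs x hx).ge) continuousOn_const hcont htT)

lemma grad_mem_closure_of_frontier (hu : FlowSol Ω h f u₀ T u) (hΩ : IsOpen Ω)
    (hh : DefFn Ω' h θ Θ) (hu₀ : InitData Ω Ω' α u₀) (hT : 0 < T)
    {x : Eucl n} (hx : x ∈ frontier Ω) {t : ℝ} (htT : t ∈ Icc 0 T) :
    grad (fun y => u y t) x ∈ closure Ω' := by
  have hx' := frontier_subset_closure hx
  have hcont := continuousOn_time hu.continuousOn_grad hx'
  refine IsClosed.Icc_subset_of_forall_mem_nhdsWithin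
    (s := {s | grad (fun y => u y s) x ∈ closure Ω'}) ?_
    (hu.grad_zero_mem_closure hΩ hu₀ hT hx') ?_ htT
  · rw [inter_comm]
    exact hcont.preimage_isClosed_of_isClosed isClosed_Icc isClosed_closure
  · rintro s ⟨hs, hsT⟩
    have hev := (hcont s (Ico_subset_Icc_self hsT)).eventually
      (hh.eventually_mem_closure hs (hu.h_grad_eq_zero hh hT hx (Ico_subset_Icc_self hsT)))
    have hsub : 𝓝[>] s ≤ 𝓝[Icc 0 T] s := by
      rw [← nhdsWithin_Ioc_eq_nhdsGT hsT.2]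
      exact nhdsWithin_mono _ (Ioc_subset_Icc_self.trans (Icc_subset_Icc_left hsT.1))
    have hIcc : ∀ᶠ r in 𝓝[>] s, r ∈ Icc 0 T := hsub self_mem_nhdsWithin
    filter_upwards [hsub hev, hIcc] with r hr hrT
    exact hr (hu.h_grad_eq_zero hh hT hx hrT)

lemma grad_mem_closure (hu : FlowSol Ω h f u₀ T u) (hΩ : NiceDomain Ω) (hΩ' : NiceDomain Ω')
    (hh : DefFn Ω' h θ Θ) (hu₀ : InitData Ω Ω' α u₀) (hT : 0 < T)
    {x : Eucl n} (hx : x ∈ closure Ω) {t : ℝ} (htT : t ∈ Icc 0 T) :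
    grad (fun y => u y t) x ∈ closure Ω' := by
  rcases htT.1.eq_or_lt with rfl | ht0
  · exact hu.grad_zero_mem_closure hΩ.isOpen hu₀ hT hx
  · have htT' : t ∈ Ioc 0 T := ⟨ht0, htT.2⟩
    exact _root_.grad_mem_closure_of_frontier hΩ hΩ'.convex hΩ'.nonempty (hu.c2Closure htT')
      (hu.sconv t htT')
      (fun y hy => hu.grad_mem_closure_of_frontier hΩ.isOpen hh hu₀ hT hy htT) hx

/-- The speed comparison at a spatial maximum of the difference of two time slices. -/
lemma deriv_le_of_max (hu : FlowSol Ω h f u₀ T u) (hΩ : NiceDomain Ω) (hΩ' : NiceDomain Ω')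
    (hh : DefFn Ω' h θ Θ) (hht : DefFn Ω ht θt Θt) (hu₀ : InitData Ω Ω' α u₀)
    (hf : MemA Ω Ω' f) (hT : 0 < T) {t₁ t₂ : ℝ} (ht₁ : t₁ ∈ Ioc 0 T) (ht₂ : t₂ ∈ Ioc 0 T)
    {x : Eucl n} (hx : x ∈ closure Ω)
    (hmax : ∀ z ∈ closure Ω, u z t₁ - u z t₂ ≤ u x t₁ - u x t₂) :
    deriv (u x) t₁ ≤ deriv (u x) t₂ := by
  have ha := hu.c2Closure ht₁
  have hb := hu.c2Closure ht₂
  have hgm : ∀ {t}, t ∈ Ioc 0 T → ∀ z ∈ closure Ω, grad (fun y => u y t) z ∈ closure Ω' :=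
    fun ht z hz => hu.grad_mem_closure hΩ hΩ' hh hu₀ hT hz (Ioc_subset_Icc_self ht)
  have hgrad := grad_eq_of_max hΩ hΩ' hh hht ha hb (hu.sconv t₂ ht₂) (hgm ht₁) (hgm ht₂)
    (hu.bdry t₂ ht₂) hx hmax
  have hqf := qf_hess_le_of_max_of_defFn hΩ hht ha hb hx hgrad hmax
  have hcl : ∀ {F : Eucl n → ℝ}, ContinuousOn F (closure Ω) →
      Tendsto F (𝓝[Ω] x) (𝓝 (F x)) := fun hF =>
    (hF x hx).mono_left (nhdsWithin_mono _ subset_closure)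
  have hne : (𝓝[Ω] x).NeBot := mem_closure_iff_nhdsWithin_neBot.mp hx
  have hherm : ∀ {t}, t ∈ Ioc 0 T →
      ∀ᶠ y in 𝓝[Ω] x, (hess (fun y => u y t) y).IsHermitian := fun ht => by
    filter_upwards [self_mem_nhdsWithin] with y hy
    exact (hu.sconv _ ht y hy).isHermitian
  have hfc : ∀ {t}, t ∈ Ioc 0 T →
      Tendsto (fun y => deriv (u y) t + f y (grad (fun z => u z t) y)) (𝓝[Ω] x)
        (𝓝 (deriv (u x) t + f x (grad (fun z => u z t) x))) := fun ht =>
    hcl ((continuousOn_space hu.cont_time (Ioc_subset_Icc_self ht)).add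
      (hf.continuousOn_comp continuousOn_id (hu.c2Closure ht).cont_grad (mapsTo_id _) (hgm ht)))
  refine le_of_forall_pos_le_add fun ε hε => ?_
  have hlim := le_of_tendsto_of_tendsto (hfc ht₁) ((hfc ht₂).add_const ε) (by
    filter_upwards [self_mem_nhdsWithin, eventually_Fop_le (hherm ht₁) (hherm ht₂)
      (fun i j => hcl (ha.cont_hess i j)) (fun i j => hcl (hb.cont_hess i j)) hqf hε]
      with y hy hF
    rw [hu.eqn t₁ ht₁ y hy, hu.eqn t₂ ht₂ y hy]
    linarith)
  rw [hgrad] at hlim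
  linarith

/-- The flow equation at time zero. -/
lemma deriv_zero_eq (hu : FlowSol Ω h f u₀ T u) (hΩ : NiceDomain Ω) (hΩ' : NiceDomain Ω')
    (hh : DefFn Ω' h θ Θ) (hu₀ : InitData Ω Ω' α u₀)
    (hf : MemA Ω Ω' f) (hT : 0 < T) {x : Eucl n} (hx : x ∈ Ω) :
    deriv (u x) 0 = Fop (hess u₀ x) - f x (grad u₀ x) := by
  have hx' := subset_closure hx
  have h0 : (0 : ℝ) ∈ Icc 0 T := left_mem_Icc.mpr hT.le
  have hcl : ∀ {F : ℝ → ℝ}, ContinuousOn F (Icc 0 T) →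
      Tendsto F (𝓝[Ioc 0 T] 0) (𝓝 (F 0)) := fun hF =>
    (hF 0 h0).mono_left (nhdsWithin_mono _ Ioc_subset_Icc_self)
  have hne : (𝓝[Ioc 0 T] (0 : ℝ)).NeBot :=
    mem_closure_iff_nhdsWithin_neBot.mp (by rwa [closure_Ioc hT.ne])
  have hherm : ∀ᶠ t in 𝓝[Ioc 0 T] 0, (hess (fun y => u y t) x).IsHermitian := by
    filter_upwards [self_mem_nhdsWithin] with t ht
    exact (hu.sconv _ ht x hx).isHermitian
  have hherm0 : ∀ᶠ _t in 𝓝[Ioc 0 T] (0 : ℝ), (hess u₀ x).IsHermitian :=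
    Eventually.of_forall fun _ => hu₀.hess_isHermitian hx'
  have hfc : Tendsto (fun t => deriv (u x) t + f x (grad (fun y => u y t) x)) (𝓝[Ioc 0 T] 0)
      (𝓝 (deriv (u x) 0 + f x (grad (fun y => u y 0) x))) :=
    hcl ((continuousOn_time hu.cont_time hx').add
      (hf.continuousOn_comp (continuousOn_const (c := x))
        (continuousOn_time hu.continuousOn_grad hx') (fun _ _ => hx')
        (fun t ht => hu.grad_mem_closure hΩ hΩ' hh hu₀ hT hx' ht)))
  rw [hu.grad_init hΩ.isOpen hx] at hfc
  have hH : ∀ i j, Tendsto (fun t => hess (fun y => u y t) x i j) (𝓝[Ioc 0 T] 0)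
      (𝓝 (hess u₀ x i j)) := fun i j => by
    have := hcl (continuousOn_time (hu.cont_hess i j) hx')
    simpa only [hu.hess_init hΩ.isOpen hx] using this
  suffices deriv (u x) 0 + f x (grad u₀ x) = Fop (hess u₀ x) by linarith
  refine le_antisymm (le_of_forall_pos_le_add fun ε hε => ?_)
    (le_of_forall_pos_le_add fun ε hε => ?_)
  · refine le_of_tendsto hfc ?_
    filter_upwards [self_mem_nhdsWithin, eventually_Fop_le hherm hherm0 hH
      (fun _ _ => tendsto_const_nhds) (fun _ => le_rfl) hε] with t ht hF
    rw [hu.eqn t ht x hx]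
    linarith
  · refine ge_of_tendsto (hfc.add_const ε) ?_
    filter_upwards [self_mem_nhdsWithin, eventually_Fop_le hherm0 hherm
      (fun _ _ => tendsto_const_nhds) hH (fun _ => le_rfl) hε] with t ht hF
    rw [hu.eqn t ht x hx]
    linarith

lemma hasDerivAt_time (hu : FlowSol Ω h f u₀ T u) {x : Eucl n} (hx : x ∈ Ω) {t : ℝ}
    (ht : t ∈ Ioo 0 T) : HasDerivAt (u x) (deriv (u x) t) t :=
  (((hu.regt x hx).contDiffAt (Ioc_mem_nhds ht.1 ht.2)).differentiableAt
    (by norm_num)).hasDerivAt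

end FlowSol

/-! ### The maximum principle in time -/

lemma sub_le_mul_sub_of_hasDerivAt_le {φ ψ : ℝ → ℝ} {s t C : ℝ} (hst : s ≤ t)
    (hφ : ContinuousOn φ (Icc s t)) (hd : ∀ r ∈ Ioo s t, HasDerivAt φ (ψ r) r)
    (hC : ∀ r ∈ Ioo s t, ψ r ≤ C) : φ t - φ s ≤ C * (t - s) := by
  refine (convex_Icc s t).image_sub_le_mul_sub_of_deriv_le hφ ?_ ?_ s (left_mem_Icc.mpr hst) t
    (right_mem_Icc.mpr hst) hst
  · rw [interior_Icc]
    exact fun r hr => (hd r hr).differentiableAt.differentiableWithinAt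
  · rw [interior_Icc]
    exact fun r hr => (hd r hr).deriv.trans_le (hC r hr)

lemma le_of_deriv_nonpos_at_max {E : Type*} [TopologicalSpace E] {Ω : Set E}
    (hΩ : IsCompact (closure Ω)) {L M : ℝ} {W G : E → ℝ → ℝ}
    (hW : ContinuousOn (fun q : E × ℝ => W q.1 q.2) (closure Ω ×ˢ Icc 0 L))
    (hG : ContinuousOn (fun q : E × ℝ => G q.1 q.2) (closure Ω ×ˢ Icc 0 L))
    (hd : ∀ x ∈ Ω, ∀ t ∈ Ioo 0 L, HasDerivAt (W x) (G x t) t)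
    (hmax : ∀ t ∈ Ioc 0 L, ∀ x ∈ closure Ω, (∀ z ∈ closure Ω, W z t ≤ W x t) → G x t ≤ 0)
    (h0 : ∀ x ∈ closure Ω, W x 0 ≤ M) {x : E} (hx : x ∈ closure Ω) {t : ℝ}
    (ht : t ∈ Icc 0 L) : W x t ≤ M := by
  suffices H : ∀ ε > 0, W x t - ε * t ≤ M by
    refine le_of_forall_pos_le_add fun ε hε => ?_
    have h1 := H (ε / (t + 1)) (div_pos hε (by linarith [ht.1]))
    have h2 : ε / (t + 1) * t ≤ ε := by
      rw [div_mul_eq_mul_div, div_le_iff₀ (by linarith [ht.1])]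
      nlinarith
    linarith
  intro ε hε
  obtain ⟨⟨x₀, t₀⟩, ⟨hx₀, ht₀⟩, hm⟩ := (hΩ.prod isCompact_Icc).exists_isMaxOn ⟨(x, t), hx, ht⟩
    (hW.sub (by fun_prop : ContinuousOn (fun q : E × ℝ => ε * q.2) (closure Ω ×ˢ Icc 0 L)))
  have hm' : ∀ z ∈ closure Ω, ∀ r ∈ Icc 0 L, W z r - ε * r ≤ W x₀ t₀ - ε * t₀ :=
    fun z hz r hr => hm (a := (z, r)) ⟨hz, hr⟩
  refine (hm' x hx t ht).trans ?_
  rcases ht₀.1.eq_or_lt with rfl | hpos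
  · simpa using h0 x₀ hx₀
  exfalso
  have hG0 : G x₀ t₀ < ε / 2 :=
    (hmax t₀ ⟨hpos, ht₀.2⟩ x₀ hx₀ fun z hz => by linarith [hm' z hz t₀ ht₀]).trans_lt (by linarith)
  have hev := (hG (x₀, t₀) ⟨hx₀, ht₀⟩).eventually (gt_mem_nhds hG0)
  rw [nhdsWithin_prod_eq, eventually_prod_iff] at hev
  obtain ⟨P, hP, Q, hQ, hPQ⟩ := hev
  have hQ' : ∀ᶠ r in 𝓝[≤] t₀, Q r := by
    rw [← nhdsWithin_Icc_eq_nhdsLE hpos]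
    exact hQ.filter_mono (nhdsWithin_mono _ (Icc_subset_Icc_right ht₀.2))
  obtain ⟨s, hs, hsQ⟩ := (mem_nhdsLE_iff_exists_mem_Ico_Ioc_subset hpos).mp hQ'
  have hsub : Icc s t₀ ⊆ Icc 0 L := Icc_subset_Icc hs.1 ht₀.2
  have hne : (𝓝[Ω] x₀).NeBot := mem_closure_iff_nhdsWithin_neBot.mp hx₀
  have hslice : ∀ r ∈ Icc 0 L, Tendsto (fun y => W y r) (𝓝[Ω] x₀) (𝓝 (W x₀ r)) := fun r hr =>
    (hW.comp (f := fun y => (y, r)) (by fun_prop) (fun y hy => ⟨hy, hr⟩) x₀ hx₀).mono_left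
      (nhdsWithin_mono _ subset_closure)
  have hs' : s ∈ Icc 0 L := hsub (left_mem_Icc.mpr hs.2.le)
  have hle : W x₀ t₀ - W x₀ s ≤ ε / 2 * (t₀ - s) := by
    refine le_of_tendsto ((hslice t₀ ht₀).sub (hslice s hs')) ?_
    filter_upwards [self_mem_nhdsWithin, hP.filter_mono (nhdsWithin_mono _ subset_closure)]
      with y hy hyP
    refine sub_le_mul_sub_of_hasDerivAt_le hs.2.le ?_
      (fun r hr => hd y hy r ⟨hs.1.trans_lt hr.1, hr.2.trans_le ht₀.2⟩)
      (fun r hr => (hPQ hyP (hsQ (Ioo_subset_Ioc_self hr))).le)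
    exact hW.comp (f := fun r => (y, r)) (by fun_prop)
      fun r hr => ⟨subset_closure hy, hsub hr⟩
  nlinarith [hm' x₀ hx₀ s hs', hs.2]

namespace FlowSol

variable {n : ℕ} {Ω Ω' : Set (Eucl n)} {h ht : Eucl n → ℝ} {θ Θ θt Θt : ℝ} {α : NNReal}
  {u₀ : Eucl n → ℝ} {f : Eucl n → Eucl n → ℝ} {T : ℝ} {u : Eucl n → ℝ → ℝ}

/-- The increments of `σ u` over a time step `s` do not exceed their maximum over the first
step. -/
lemma mul_sub_le_of_forall_init (hu : FlowSol Ω h f u₀ T u) (hΩ : NiceDomain Ω)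
    (hΩ' : NiceDomain Ω') (hh : DefFn Ω' h θ Θ) (hht : DefFn Ω ht θt Θt)
    (hu₀ : InitData Ω Ω' α u₀) (hf : MemA Ω Ω' f) (hT : 0 < T) {σ : ℝ} (hσ : σ = 1 ∨ σ = -1)
    {s M : ℝ} (hs : 0 < s) (hM : ∀ y ∈ closure Ω, σ * (u y s - u y 0) ≤ M)
    {x : Eucl n} (hx : x ∈ closure Ω) {t : ℝ} (ht : t ∈ Icc 0 (T - s)) :
    σ * (u x (t + s) - u x t) ≤ M := by
  have hmap₁ : MapsTo (fun q : Eucl n × ℝ => (q.1, q.2 + s)) (closure Ω ×ˢ Icc 0 (T - s))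
      (closure Ω ×ˢ Icc 0 T) := fun q hq => ⟨hq.1, by linarith [hq.2.1], by linarith [hq.2.2]⟩
  have hmap₂ : closure Ω ×ˢ Icc 0 (T - s) ⊆ closure Ω ×ˢ Icc 0 T :=
    prod_mono_right (Icc_subset_Icc_right (by linarith))
  have hdiff : ∀ {F : Eucl n × ℝ → ℝ}, ContinuousOn F (closure Ω ×ˢ Icc 0 T) →
      ContinuousOn (fun q : Eucl n × ℝ => σ * (F (q.1, q.2 + s) - F q))
        (closure Ω ×ˢ Icc 0 (T - s)) := fun hF =>
    continuousOn_const.mul ((hF.comp (by fun_prop) hmap₁).sub (hF.mono hmap₂))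
  refine le_of_deriv_nonpos_at_max (W := fun x t => σ * (u x (t + s) - u x t))
    (G := fun x t => σ * (deriv (u x) (t + s) - deriv (u x) t)) hΩ.bounded.isCompact_closure
    (hdiff hu.cont) (hdiff hu.cont_time) (fun y hy r hr => ?_) (fun r hr y hy hmax => ?_)
    (by simpa using hM) hx ht
  · exact (((hu.hasDerivAt_time hy ⟨by linarith [hr.1], by linarith [hr.2]⟩).comp_add_const r s).sub
      (hu.hasDerivAt_time hy ⟨hr.1, by linarith [hr.2]⟩)).const_mul σ
  · have h₁ : r + s ∈ Ioc 0 T := ⟨by linarith [hr.1], by linarith [hr.2]⟩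
    have h₂ : r ∈ Ioc 0 T := ⟨hr.1, by linarith [hr.2]⟩
    rcases hσ with rfl | rfl
    · have := hu.deriv_le_of_max hΩ hΩ' hh hht hu₀ hf hT h₁ h₂ hy
        fun z hz => by linarith [hmax z hz]
      linarith
    · have := hu.deriv_le_of_max hΩ hΩ' hh hht hu₀ hf hT h₂ h₁ hy
        fun z hz => by linarith [hmax z hz]
      linarith

/-- A bound on the initial speed propagates to all times. -/
lemma mul_deriv_le_of_forall_init (hu : FlowSol Ω h f u₀ T u) (hΩ : NiceDomain Ω)
    (hΩ' : NiceDomain Ω') (hh : DefFn Ω' h θ Θ) (hht : DefFn Ω ht θt Θt)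
    (hu₀ : InitData Ω Ω' α u₀) (hf : MemA Ω Ω' f) (hT : 0 < T) {σ : ℝ} (hσ : σ = 1 ∨ σ = -1)
    {K : ℝ} (hK : ∀ y ∈ closure Ω, σ * deriv (u y) 0 ≤ K)
    {x : Eucl n} (hx : x ∈ closure Ω) {t : ℝ} (ht : t ∈ Icc 0 T) :
    σ * deriv (u x) t ≤ K := by
  have hcl : closure (Ω ×ˢ Ioo 0 T) = closure Ω ×ˢ Icc 0 T := by
    rw [closure_prod_eq, closure_Ioo hT.ne]
  refine le_on_closure (s := Ω ×ˢ Ioo 0 T) (f := fun q : Eucl n × ℝ => σ * deriv (u q.1) q.2)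
    (g := fun _ => K) ?_ (by rw [hcl]; exact continuousOn_const.mul hu.cont_time)
    continuousOn_const (x := (x, t)) (by rw [hcl]; exact ⟨hx, ht⟩)
  rintro ⟨y, r⟩ ⟨hy, hr⟩
  refine le_of_forall_pos_le_add fun ε hε => ?_
  have huc : UniformContinuousOn (fun q : Eucl n × ℝ => σ * deriv (u q.1) q.2)
      (closure Ω ×ˢ Icc 0 T) :=
    (hΩ.bounded.isCompact_closure.prod isCompact_Icc).uniformContinuousOn_of_continuous
      (continuousOn_const.mul hu.cont_time)
  obtain ⟨δ, hδ, hδε⟩ := Metric.uniformContinuousOn_iff.mp huc ε hε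
  have hsmall : ∀ s ∈ Ioo 0 (min δ T), ∀ z ∈ closure Ω, σ * (u z s - u z 0) ≤ (K + ε) * s := by
    rintro s ⟨hs0, hsm⟩
    have hsδ : s < δ := hsm.trans_le (min_le_left _ _)
    have hsT : s < T := hsm.trans_le (min_le_right _ _)
    refine fun z hz => le_on_closure (fun z hz => ?_) (continuousOn_const.mul
      ((continuousOn_space hu.cont ⟨hs0.le, hsT.le⟩).sub
        (continuousOn_space hu.cont (left_mem_Icc.mpr hT.le)))) continuousOn_const hz
    have hz' := subset_closure hz
    have := sub_le_mul_sub_of_hasDerivAt_le (φ := fun r => σ * u z r)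
      (ψ := fun r => σ * deriv (u z) r) (C := K + ε) hs0.le
      (continuousOn_const.mul ((continuousOn_time hu.cont hz').mono
        (Icc_subset_Icc_right hsT.le)))
      (fun r hr => (hu.hasDerivAt_time hz ⟨hr.1, hr.2.trans hsT⟩).const_mul σ) (fun r hr => by
        have h1 := hδε (z, r) ⟨hz', hr.1.le, (hr.2.trans hsT).le⟩ (z, 0)
          ⟨hz', left_mem_Icc.mpr hT.le⟩ (by
            rw [dist_prod_same_left, Real.dist_eq, sub_zero, abs_of_pos hr.1]
            exact hr.2.trans hsδ)
        rw [Real.dist_eq] at h1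
        have h2 := (abs_lt.mp h1).2
        have h3 := hK z hz'
        dsimp only at h2 ⊢
        linarith)
    change σ * (u z s - u z 0) ≤ _
    linarith
  have hslope := (hu.hasDerivAt_time hy hr).tendsto_slope_zero_right.const_mul σ
  refine le_of_tendsto hslope ?_
  have hb : 0 < min (min δ T) (T - r) := lt_min (lt_min hδ hT) (sub_pos.mpr hr.2)
  filter_upwards [Ioo_mem_nhdsGT hb] with s hs
  have h1 := hu.mul_sub_le_of_forall_init hΩ hΩ' hh hht hu₀ hf hT hσ hs.1
    (hsmall s ⟨hs.1, hs.2.trans_le (min_le_left _ _)⟩) (subset_closure hy)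
    (t := r) ⟨hr.1.le, by linarith [hs.2.trans_le (min_le_right _ _)]⟩
  rw [smul_eq_mul, mul_left_comm, inv_mul_le_iff₀ hs.1]
  linarith

lemma deriv_zero_le (hu : FlowSol Ω h f u₀ T u) (hΩ : NiceDomain Ω) (hΩ' : NiceDomain Ω')
    (hh : DefFn Ω' h θ Θ) (hu₀ : InitData Ω Ω' α u₀) (hf : MemA Ω Ω' f) (hT : 0 < T)
    {x : Eucl n} (hx : x ∈ closure Ω) :
    deriv (u x) 0 ≤ maxF Ω u₀ - sInf ((fun y => f y (grad u₀ y)) '' closure Ω) := by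
  refine le_on_closure (fun y hy => ?_)
    (continuousOn_space hu.cont_time (left_mem_Icc.mpr hT.le)) continuousOn_const hx
  have hy' := subset_closure hy
  have hF : Fop (hess u₀ y) ≤ maxF Ω u₀ :=
    le_csSup ⟨n * (π / 2), forall_mem_image.mpr fun z _ => (abs_le.mp (abs_Fop_le _)).2⟩
      (mem_image_of_mem _ hy')
  have hf' : sInf ((fun y => f y (grad u₀ y)) '' closure Ω) ≤ f y (grad u₀ y) :=
    csInf_le (hΩ.bounded.isCompact_closure.image_of_continuousOn
      (hf.continuousOn_comp continuousOn_id hu₀.continuousOn_grad (mapsTo_id _)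
        fun _ hz => hu₀.grad_mem_closure hz)).bddBelow (mem_image_of_mem _ hy')
  dsimp only
  rw [hu.deriv_zero_eq hΩ hΩ' hh hu₀ hf hT hy]
  linarith

lemma le_deriv_zero (hu : FlowSol Ω h f u₀ T u) (hΩ : NiceDomain Ω) (hΩ' : NiceDomain Ω')
    (hh : DefFn Ω' h θ Θ) (hu₀ : InitData Ω Ω' α u₀) (hf : MemA Ω Ω' f) (hT : 0 < T)
    {x : Eucl n} (hx : x ∈ closure Ω) :
    minF Ω u₀ - sSup ((fun y => f y (grad u₀ y)) '' closure Ω) ≤ deriv (u x) 0 := by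
  refine le_on_closure (fun y hy => ?_) continuousOn_const
    (continuousOn_space hu.cont_time (left_mem_Icc.mpr hT.le)) hx
  have hy' := subset_closure hy
  have hF : minF Ω u₀ ≤ Fop (hess u₀ y) :=
    csInf_le ⟨-(n * (π / 2)), forall_mem_image.mpr fun z _ => (abs_le.mp (abs_Fop_le _)).1⟩
      (mem_image_of_mem _ hy')
  have hf' : f y (grad u₀ y) ≤ sSup ((fun y => f y (grad u₀ y)) '' closure Ω) :=
    le_csSup (hΩ.bounded.isCompact_closure.image_of_continuousOn
      (hf.continuousOn_comp continuousOn_id hu₀.continuousOn_grad (mapsTo_id _)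
        fun _ hz => hu₀.grad_mem_closure hz)).bddAbove (mem_image_of_mem _ hy')
  dsimp only
  rw [hu.deriv_zero_eq hΩ hΩ' hh hu₀ hf hT hy]
  linarith

end FlowSol

theorem stmt_5 {n : ℕ} (hn : 2 ≤ n) {Ω Ω' : Set (Eucl n)} {h ht : Eucl n → ℝ}
    {θ Θ θt Θt : ℝ}
    (hΩ : NiceDomain Ω) (hΩ' : NiceDomain Ω')
    (hdefh : DefFn Ω' h θ Θ) (hdefht : DefFn Ω ht θt Θt)
    {α : NNReal} {u₀ : Eucl n → ℝ} (hu₀ : InitData Ω Ω' α u₀)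
    {f : Eucl n → Eucl n → ℝ} (hf : MemA Ω Ω' f)
    {T : ℝ} (hT : 0 < T) {u : Eucl n → ℝ → ℝ} (hu : FlowSol Ω h f u₀ T u) :
    ∀ x ∈ closure Ω, ∀ t ∈ Icc (0 : ℝ) T,
      minF Ω u₀ - sSup ((fun y => f y (grad u₀ y)) '' closure Ω) ≤ deriv (u x) t ∧
      deriv (u x) t ≤ maxF Ω u₀ - sInf ((fun y => f y (grad u₀ y)) '' closure Ω) := by
  intro x hx t htT
  constructor
  · have := hu.mul_deriv_le_of_forall_init hΩ hΩ' hdefh hdefht hu₀ hf hT (σ := -1) (Or.inr rfl)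
      (fun y hy => by
        rw [neg_one_mul]
        exact neg_le_neg (hu.le_deriv_zero hΩ hΩ' hdefh hu₀ hf hT hy)) hx htT
    linarith
  · have := hu.mul_deriv_le_of_forall_init hΩ hΩ' hdefh hdefht hu₀ hf hT (σ := 1) (Or.inl rfl)
      (fun y hy => by
        rw [one_mul]
        exact hu.deriv_zero_le hΩ hΩ' hdefh hu₀ hf hT hy) hx htT
    linarith
end
end

section
/- On the set of real symmetric positive definite n×n matrices, the function F[A] := Σ_{i=1}^n arctan(λᵢ(A)) (where λ₁(A),…,λₙ(A) are the eigenvalues of A) satisfies: (i) 0 < F[A] < nπ/2; (ii) F is strictly monotone: if A and B are symmetric positive definite with B − A positive semidefinite, then F[A] ≤ F[B], with strict inequality if B − A is nonzero; (iii) F is concave: for all symmetric positive definite A, B and s ∈ [0,1], F[sA + (1−s)B] ≥ s·F[A] + (1−s)·F[B]. -/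
open Real Set

noncomputable section

theorem concaveOn_arctan_Ici : ConcaveOn ℝ (Ici 0) Real.arctan := by
  refine AntitoneOn.concaveOn_of_deriv (convex_Ici 0) Real.continuous_arctan.continuousOn
    Real.differentiable_arctan.differentiableOn ?_
  intro x hx y _ hxy
  have hx' : 0 < x := by simpa using hx
  simp only [Real.deriv_arctan]
  gcongr

theorem Fop_eq_sum {n : ℕ} {A : Matrix (Fin n) (Fin n) ℝ} (hA : A.IsHermitian) :
    Fop A = ∑ i, Real.arctan (hA.eigenvalues i) := by
  simp only [Fop, eigs, dif_pos hA]

/-- Conjugating a symmetric matrix by an orthogonal matrix: the diagonal entries are averages of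
the eigenvalues with doubly stochastic weights. -/
theorem exists_doublyStochastic_diag_eq {n : ℕ} {A : Matrix (Fin n) (Fin n) ℝ}
    (hA : A.IsHermitian) {U : Matrix (Fin n) (Fin n) ℝ}
    (hU : U ∈ Matrix.unitaryGroup (Fin n) ℝ) :
    ∃ w : Fin n → Fin n → ℝ, (∀ i j, 0 ≤ w i j) ∧ (∀ i, ∑ j, w i j = 1) ∧
      (∀ j, ∑ i, w i j = 1) ∧ ∀ i, (star U * A * U) i i = ∑ j, w i j * hA.eigenvalues j := by
  obtain ⟨V, hV⟩ : ∃ V : Matrix.unitaryGroup (Fin n) ℝ,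
      V = (⟨U, hU⟩ : Matrix.unitaryGroup (Fin n) ℝ)⁻¹ * hA.eigenvectorUnitary := ⟨_, rfl⟩
  have hV' : (V : Matrix (Fin n) (Fin n) ℝ) = star U * hA.eigenvectorUnitary := by
    rw [hV]; rfl
  refine ⟨fun i j => (V : Matrix (Fin n) (Fin n) ℝ) i j ^ 2, fun i j => sq_nonneg _, fun i => ?_,
    fun j => ?_, fun i => ?_⟩
  · have h := congrFun₂ (Matrix.mem_unitaryGroup_iff.mp V.2) i i
    simpa [Matrix.mul_apply, sq] using h
  · have h := congrFun₂ (Matrix.mem_unitaryGroup_iff'.mp V.2) j j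
    simpa [Matrix.mul_apply, sq] using h
  · have h : star U * A * U = (V : Matrix (Fin n) (Fin n) ℝ) *
        Matrix.diagonal hA.eigenvalues * star (V : Matrix (Fin n) (Fin n) ℝ) := by
      conv_lhs => rw [hA.spectral_theorem, Unitary.conjStarAlgAut_apply]
      rw [hV', star_mul, star_star]
      simp only [Matrix.mul_assoc]
      rfl
    rw [h, Matrix.mul_apply]
    refine Finset.sum_congr rfl fun j _ => ?_
    simp only [Matrix.mul_diagonal, Matrix.star_apply, star_trivial]
    ring

theorem Fop_le_sum_arctan_diag {n : ℕ} {A : Matrix (Fin n) (Fin n) ℝ} (hA : A.PosDef)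
    {U : Matrix (Fin n) (Fin n) ℝ} (hU : U ∈ Matrix.unitaryGroup (Fin n) ℝ) :
    Fop A ≤ ∑ i, Real.arctan ((star U * A * U) i i) := by
  obtain ⟨w, hw0, hrow, hcol, hdiag⟩ := exists_doublyStochastic_diag_eq hA.1 hU
  calc Fop A = ∑ j, (∑ i, w i j) * Real.arctan (hA.1.eigenvalues j) := by
        simp [Fop_eq_sum hA.1, hcol]
    _ = ∑ i, ∑ j, w i j * Real.arctan (hA.1.eigenvalues j) := by
        simp_rw [Finset.sum_mul]
        exact Finset.sum_comm
    _ ≤ ∑ i, Real.arctan ((star U * A * U) i i) := by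
        refine Finset.sum_le_sum fun i _ => ?_
        rw [hdiag i]
        simpa using concaveOn_arctan_Ici.le_map_sum (t := Finset.univ) (w := w i)
          (p := hA.1.eigenvalues) (fun j _ => hw0 i j) (hrow i)
          (fun j _ => (hA.eigenvalues_pos j).le)

theorem exists_unitary_Fop_eq_sum_arctan_diag {n : ℕ} {A : Matrix (Fin n) (Fin n) ℝ}
    (hA : A.IsHermitian) :
    ∃ U ∈ Matrix.unitaryGroup (Fin n) ℝ, Fop A = ∑ i, Real.arctan ((star U * A * U) i i) := by
  refine ⟨hA.eigenvectorUnitary, hA.eigenvectorUnitary.2, ?_⟩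
  have h := hA.conjStarAlgAut_star_eigenvectorUnitary
  rw [Unitary.conjStarAlgAut_apply] at h
  simp only [Unitary.coe_star, star_star] at h
  rw [Fop_eq_sum hA, h]
  simp

theorem Fop_pos {n : ℕ} (hn : 0 < n) {A : Matrix (Fin n) (Fin n) ℝ} (hA : A.PosDef) :
    0 < Fop A := by
  have : Nonempty (Fin n) := ⟨⟨0, hn⟩⟩
  rw [Fop_eq_sum hA.1]
  exact Finset.sum_pos (fun i _ => Real.arctan_pos.mpr (hA.eigenvalues_pos i))
    Finset.univ_nonempty

theorem Fop_lt {n : ℕ} (hn : 0 < n) (A : Matrix (Fin n) (Fin n) ℝ) :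
    Fop A < (n : ℝ) * π / 2 := by
  have : Nonempty (Fin n) := ⟨⟨0, hn⟩⟩
  calc Fop A < ∑ _i : Fin n, π / 2 :=
        Finset.sum_lt_sum_of_nonempty Finset.univ_nonempty
          fun i _ => Real.arctan_lt_pi_div_two _
    _ = (n : ℝ) * π / 2 := by simp [mul_div_assoc]

theorem Fop_mono {n : ℕ} {A B : Matrix (Fin n) (Fin n) ℝ} (hA : A.PosDef) (hB : B.PosDef)
    (hAB : (B - A).PosSemidef) : Fop A ≤ Fop B ∧ (B - A ≠ 0 → Fop A < Fop B) := by
  obtain ⟨U, hU, hFB⟩ := exists_unitary_Fop_eq_sum_arctan_diag hB.1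
  have hFA := Fop_le_sum_arctan_diag hA hU
  have hpsd : (star U * (B - A) * U).PosSemidef := hAB.conjTranspose_mul_mul_same U
  have hsub : star U * (B - A) * U = star U * B * U - star U * A * U := by
    rw [Matrix.mul_sub, Matrix.sub_mul]
  have hle : ∀ i, (star U * A * U) i i ≤ (star U * B * U) i i := fun i => by
    have h := hpsd.diag_nonneg (i := i)
    rw [hsub, Matrix.sub_apply] at h
    linarith
  refine ⟨hFB ▸ hFA.trans (Finset.sum_le_sum fun i _ => Real.arctan_mono (hle i)), fun hne => ?_⟩
  rw [hFB]
  refine hFA.trans_lt (Finset.sum_lt_sum (fun i _ => Real.arctan_mono (hle i)) ?_)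
  by_contra! hcon
  refine hne (hAB.trace_eq_zero_iff.mp ?_)
  have htr : (star U * (B - A) * U).trace = (B - A).trace := by
    rw [Matrix.trace_mul_cycle, Matrix.mem_unitaryGroup_iff.mp hU, Matrix.one_mul]
  rw [← htr, hsub]
  refine Finset.sum_eq_zero fun i _ => ?_
  have h := Real.arctan_le_arctan_iff.mp (hcon i (Finset.mem_univ i))
  simpa using sub_eq_zero.mpr (le_antisymm h (hle i))

theorem Fop_concave {n : ℕ} {A B : Matrix (Fin n) (Fin n) ℝ} (hA : A.PosDef) (hB : B.PosDef)
    {s : ℝ} (hs : s ∈ Icc (0 : ℝ) 1) :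
    s * Fop A + (1 - s) * Fop B ≤ Fop (s • A + (1 - s) • B) := by
  have hs' : 0 ≤ 1 - s := sub_nonneg.mpr hs.2
  have hC : (s • A + (1 - s) • B).IsHermitian :=
    ((hA.posSemidef.smul hs.1).add (hB.posSemidef.smul hs')).1
  obtain ⟨U, hU, hFC⟩ := exists_unitary_Fop_eq_sum_arctan_diag hC
  have hnn : ∀ {M : Matrix (Fin n) (Fin n) ℝ}, M.PosDef → ∀ i, 0 ≤ (star U * M * U) i i :=
    fun hM i => (hM.posSemidef.conjTranspose_mul_mul_same U).diag_nonneg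
  calc s * Fop A + (1 - s) * Fop B
      ≤ s * ∑ i, Real.arctan ((star U * A * U) i i) +
          (1 - s) * ∑ i, Real.arctan ((star U * B * U) i i) :=
        add_le_add (mul_le_mul_of_nonneg_left (Fop_le_sum_arctan_diag hA hU) hs.1)
          (mul_le_mul_of_nonneg_left (Fop_le_sum_arctan_diag hB hU) hs')
    _ = ∑ i, (s * Real.arctan ((star U * A * U) i i) +
          (1 - s) * Real.arctan ((star U * B * U) i i)) := by
        rw [Finset.mul_sum, Finset.mul_sum, Finset.sum_add_distrib]
    _ ≤ Fop (s • A + (1 - s) • B) := by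
        rw [hFC]
        refine Finset.sum_le_sum fun i _ => ?_
        have h := concaveOn_arctan_Ici.2 (hnn hA i) (hnn hB i) hs.1 hs' (by ring)
        simpa [Matrix.mul_add, Matrix.add_mul] using h

theorem stmt_18 {n : ℕ} (hn : 0 < n) :
    (∀ A : Matrix (Fin n) (Fin n) ℝ, A.PosDef →
      0 < Fop A ∧ Fop A < (n : ℝ) * π / 2) ∧
    (∀ A B : Matrix (Fin n) (Fin n) ℝ, A.PosDef → B.PosDef → (B - A).PosSemidef →
      Fop A ≤ Fop B ∧ (B - A ≠ 0 → Fop A < Fop B)) ∧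
    (∀ A B : Matrix (Fin n) (Fin n) ℝ, A.PosDef → B.PosDef → ∀ s ∈ Icc (0 : ℝ) 1,
      s * Fop A + (1 - s) * Fop B ≤ Fop (s • A + (1 - s) • B)) := by
  exact ⟨fun A hA => ⟨Fop_pos hn hA, Fop_lt hn A⟩, fun A B hA hB hAB => Fop_mono hA hB hAB,
    fun A B hA hB s hs => Fop_concave hA hB hs⟩
end
end
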